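/- arXiv:math/0412336 — 3 statements merged into one kernel-verified Lean document; each statement's English description precedes it below -/
import Mathlib

section
/- Assume all gaps are open and let B be a band with interior B°. Let N^{(n)} denote the number of zeros of p_n lying in B°. Then for every integer m ≥ 1 and every integer r with −1 ≤ r ≤ p − 1, |N^{(mp+r)} − (m − 1)| ≤ min(r + 1, p − r); in particular, |N^{(n)} − n/p| ≤ 1 + p/2 for all n ≥ 1. (Theorem 2.3.) -/
open Polynomial Matrix

/-- The one-step transfer matrix `A_k(x)` for periodic OPRL (real form). -/
noncomputable def JacobiA (a b : ℕ → ℝ) (k : ℕ) (x : ℝ) : Matrix (Fin 2) (Fin 2) ℝ :=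
  (a (k + 1))⁻¹ • !![x - b (k + 1), -(a k); a (k + 1), 0]

/-- The transfer matrix `T_n(x) = A_{n-1}(x) ⋯ A_0(x)`. -/
noncomputable def JacobiT (a b : ℕ → ℝ) : ℕ → ℝ → Matrix (Fin 2) (Fin 2) ℝ
  | 0, _ => 1
  | n + 1, x => JacobiA a b n x * JacobiT a b n x

/-- The discriminant `Δ(x) = tr T_p(x)`. -/
noncomputable def JacobiDisc (a b : ℕ → ℝ) (p : ℕ) (x : ℝ) : ℝ :=
  (JacobiT a b p x).trace

/-- The band set `{x : Δ(x) ∈ [-2,2]}`. -/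
noncomputable def bandSet (a b : ℕ → ℝ) (p : ℕ) : Set ℝ :=
  {x : ℝ | JacobiDisc a b p x ∈ Set.Icc (-2 : ℝ) 2}

/-- A band is a connected component of the band set. -/
def IsBand (a b : ℕ → ℝ) (p : ℕ) (B : Set ℝ) : Prop :=
  ∃ x ∈ bandSet a b p, B = connectedComponentIn (bandSet a b p) x

/-! ### Real-rooted polynomials -/

/-- A real-rooted polynomial is log-concave where it is positive, so it has no positive local
minimum. -/
theorem Polynomial.Splits.eval_nonpos_of_isLocalMin {Q : ℝ[X]} (hQ : Q.Splits)
    (hdeg : 0 < Q.natDegree) {x : ℝ} (hx : IsLocalMin (fun y => Q.eval y) x) :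
    Q.eval x ≤ 0 := by
  by_contra! hpos
  have hcont : Continuous fun y => Q.eval y := Q.continuous
  have hd : Q.derivative.eval x = 0 := by
    have := hx.deriv_eq_zero
    rwa [Polynomial.deriv] at this
  have hev : ∀ᶠ y in nhds x, 0 < Q.eval y ∧ Q.eval x ≤ Q.eval y :=
    (hcont.continuousAt.eventually (lt_mem_nhds hpos)).and hx
  obtain ⟨ε, hε, hball⟩ := Metric.eventually_nhds_iff.1 hev
  have hnear : ∀ y ∈ Set.Icc x (x + ε / 2), 0 < Q.eval y ∧ Q.eval x ≤ Q.eval y := by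
    intro y hy
    apply hball
    rw [Real.dist_eq, abs_lt]
    constructor <;> linarith [hy.1, hy.2]
  have hroots : Q.roots ≠ ∅ := by
    intro h
    have := hQ.natDegree_eq_card_roots
    rw [h] at this
    simp at this
    omega
  have hsumx := hQ.eval_derivative_div_eval_of_ne_zero hpos.ne'
  rw [hd, zero_div] at hsumx
  have hneg : ∀ y ∈ Set.Ioo x (x + ε / 2), Q.derivative.eval y < 0 := by
    intro y hy
    have hy0 := (hnear y ⟨hy.1.le, hy.2.le⟩).1
    have hsumy := hQ.eval_derivative_div_eval_of_ne_zero hy0.ne'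
    have hlt : (Q.roots.map fun z ↦ 1 / (y - z)).sum < (Q.roots.map fun z ↦ 1 / (x - z)).sum := by
      apply Multiset.sum_lt_sum_of_nonempty hroots
      intro z hz
      have hz0 : Q.eval z = 0 := (Polynomial.mem_roots'.1 hz).2
      rcases lt_or_ge z x with h | h
      · exact one_div_lt_one_div_of_lt (by linarith) (by linarith [hy.1])
      · have hyz : y < z := by
          by_contra! hc
          have := (hnear z ⟨h, by linarith [hy.2]⟩).1
          linarith
        exact one_div_lt_one_div_of_neg_of_lt (by linarith) (by linarith [hy.1])
    rw [← hsumx, ← hsumy] at hlt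
    by_contra! hc
    exact absurd (div_nonneg hc hy0.le) (not_le.2 hlt)
  have hanti : StrictAntiOn (fun y => Q.eval y) (Set.Icc x (x + ε / 2)) := by
    apply strictAntiOn_of_deriv_neg (convex_Icc _ _) hcont.continuousOn
    intro y hy
    rw [interior_Icc] at hy
    rw [Polynomial.deriv]
    exact hneg y hy
  have h1 := hanti (Set.left_mem_Icc.2 (by linarith)) (Set.right_mem_Icc.2 (by linarith))
    (by linarith : x < x + ε / 2)
  have h2 := (hnear (x + ε / 2) ⟨by linarith, le_rfl⟩).2
  exact absurd h2 (not_le.2 h1)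

theorem Polynomial.splits_real_of_forall_im_eq_zero {Q : ℝ[X]}
    (h : ∀ w : ℂ, Polynomial.aeval w Q = 0 → w.im = 0) : Q.Splits := by
  refine Polynomial.Splits.of_splits_map (algebraMap ℝ ℂ) (IsAlgClosed.splits _) fun w hw => ?_
  have := h w ((Polynomial.eval_map_algebraMap Q w).symm.trans (Polynomial.mem_roots'.1 hw).2)
  exact ⟨w.re, Complex.ext (by simp) (by simp [this])⟩

/-! ### Zero counts of interlacing polynomials -/

/-- If the Wronskian of `f` and `g` has no zero, then between two zeros of `f` there is a zero
of `g`. -/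
theorem Polynomial.exists_root_between_of_wronskian_ne_zero {f g : ℝ[X]}
    (hW : ∀ x, f.derivative.eval x * g.eval x - g.derivative.eval x * f.eval x ≠ 0)
    {x y : ℝ} (hxy : x < y) (hx : f.eval x = 0) (hy : f.eval y = 0) :
    ∃ z ∈ Set.Ioo x y, g.eval z = 0 := by
  by_contra! hg
  have hg' : ∀ z ∈ Set.Icc x y, g.eval z ≠ 0 := by
    intro z hz h0
    rcases eq_or_lt_of_le hz.1 with rfl | h1
    · exact hW x (by simp [h0, hx])
    rcases eq_or_lt_of_le hz.2 with rfl | h2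
    · exact hW z (by simp [h0, hy])
    exact hg z ⟨h1, h2⟩ h0
  obtain ⟨z, hz, hz0⟩ := exists_hasDerivAt_eq_zero (f := fun t => f.eval t / g.eval t)
    (f' := fun t => (f.derivative.eval t * g.eval t - f.eval t * g.derivative.eval t)
      / g.eval t ^ 2) hxy
    (f.continuous.continuousOn.div g.continuous.continuousOn hg') (by simp [hx, hy])
    (fun t ht => (f.hasDerivAt t).div (g.hasDerivAt t) (hg' t ⟨ht.1.le, ht.2.le⟩))
  rw [div_eq_zero_iff] at hz0
  rcases hz0 with h | h
  · exact hW z (by linarith)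
  · exact hg' z ⟨hz.1.le, hz.2.le⟩ (by simpa using h)

theorem Polynomial.ncard_zeros_le_of_wronskian_ne_zero {f g : ℝ[X]} {I : Set ℝ}
    (hI : I.OrdConnected) (hf : f ≠ 0) (hg : g ≠ 0)
    (hW : ∀ x, f.derivative.eval x * g.eval x - g.derivative.eval x * f.eval x ≠ 0) :
    {x ∈ I | f.eval x = 0}.ncard ≤ {x ∈ I | g.eval x = 0}.ncard + 1 := by
  have hfin : ∀ {q : ℝ[X]}, q ≠ 0 → {x ∈ I | q.eval x = 0}.Finite := fun {q} hq =>
    (Polynomial.finite_setOfPred_isRoot hq).subset fun x hx => hx.2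
  rw [Set.ncard_eq_toFinset_card _ (hfin hf), Set.ncard_eq_toFinset_card _ (hfin hg)]
  refine Finset.card_le_of_interleaved fun x hx y hy hxy _ => ?_
  rw [Set.Finite.mem_toFinset] at hx hy
  obtain ⟨z, hz, hz0⟩ := Polynomial.exists_root_between_of_wronskian_ne_zero hW hxy hx.2 hy.2
  exact ⟨z, (Set.Finite.mem_toFinset _).2 ⟨hI.out hx.1 hy.1 ⟨hz.1.le, hz.2.le⟩, hz0⟩, hz.1, hz.2⟩

/-! ### Connected components of `{|f| ≤ 2}` -/

theorem IsClosed.isClosed_connectedComponentIn {α : Type*} [TopologicalSpace α] {K : Set α}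
    (hK : IsClosed K) (x : α) : IsClosed (connectedComponentIn K x) := by
  by_cases hx : x ∈ K
  · refine isClosed_of_closure_subset ?_
    exact isPreconnected_connectedComponentIn.closure.subset_connectedComponentIn
      (subset_closure (mem_connectedComponentIn hx))
      (closure_minimal (connectedComponentIn_subset K x) hK)
  · rw [connectedComponentIn_eq_empty hx]
    exact isClosed_empty

/-- If a closed set has finitely many components, each of them is relatively open. -/
theorem IsClosed.eventually_mem_connectedComponentIn {α : Type*} [TopologicalSpace α]
    {K : Set α} (hK : IsClosed K)
    (hfin : {C : Set α | ∃ x ∈ K, C = connectedComponentIn K x}.Finite) {x y : α}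
    (hy : y ∈ connectedComponentIn K x) :
    ∀ᶠ z in nhds y, z ∈ K → z ∈ connectedComponentIn K x := by
  have hcl : IsClosed
      (⋃ C ∈ {C : Set α | ∃ x ∈ K, C = connectedComponentIn K x} \ {connectedComponentIn K x},
        C) := by
    refine (hfin.subset Set.sdiff_subset).isClosed_biUnion ?_
    rintro C ⟨⟨w, _, rfl⟩, _⟩
    exact hK.isClosed_connectedComponentIn w
  have hynot : y ∉ ⋃ C ∈ {C : Set α | ∃ x ∈ K, C = connectedComponentIn K x} \
      {connectedComponentIn K x}, C := by
    intro h
    simp only [Set.mem_iUnion] at h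
    obtain ⟨C, ⟨⟨w, _, rfl⟩, hne⟩, hyC⟩ := h
    exact hne ((connectedComponentIn_eq hyC).trans (connectedComponentIn_eq hy).symm)
  filter_upwards [hcl.isOpen_compl.mem_nhds hynot] with z hz hzK
  by_contra hzC
  refine hz ?_
  simp only [Set.mem_iUnion]
  refine ⟨connectedComponentIn K z, ⟨⟨z, hzK, rfl⟩, fun h => hzC ?_⟩, mem_connectedComponentIn hzK⟩
  rw [← Set.mem_singleton_iff.1 h]
  exact mem_connectedComponentIn hzK

theorem exists_le_neg_two_of_isLocalMin {f : ℝ → ℝ} (hf : Continuous f) {K : Set ℝ}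
    (hK : ∀ x, x ∈ K ↔ |f x| ≤ 2) (hcomp : IsCompact K)
    (hfin : {C : Set ℝ | ∃ x ∈ K, C = connectedComponentIn K x}.Finite)
    (hmin : ∀ x, IsLocalMin f x → f x ≤ -2) {x : ℝ} (hx : x ∈ K) :
    ∃ y ∈ connectedComponentIn K x, f y ≤ -2 := by
  have hC : IsCompact (connectedComponentIn K x) :=
    hcomp.of_isClosed_subset (hcomp.isClosed.isClosed_connectedComponentIn x)
      (connectedComponentIn_subset K x)
  obtain ⟨y, hy, hymin⟩ := hC.exists_isMinOn ⟨x, mem_connectedComponentIn hx⟩ hf.continuousOn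
  refine ⟨y, hy, ?_⟩
  by_contra! hlt
  refine absurd (hmin y ?_) (not_le.2 hlt)
  filter_upwards [hcomp.isClosed.eventually_mem_connectedComponentIn hfin hy,
    hf.continuousAt.eventually (lt_mem_nhds hlt)] with z hz hz2
  by_cases hzK : z ∈ K
  · exact hymin (hz hzK)
  · have hz3 : 2 < |f z| := not_le.1 fun h => hzK ((hK z).2 h)
    have hy2 : f y ≤ 2 := (abs_le.1 ((hK y).1 (connectedComponentIn_subset K x hy))).2
    rcases lt_abs.1 hz3 with h | h
    · linarith
    · linarith

theorem Icc_subset_image_connectedComponentIn {f : ℝ → ℝ} (hf : Continuous f) {K : Set ℝ}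
    (hK : ∀ x, x ∈ K ↔ |f x| ≤ 2) (hcomp : IsCompact K)
    (hfin : {C : Set ℝ | ∃ x ∈ K, C = connectedComponentIn K x}.Finite)
    (hmin : ∀ x, IsLocalMin f x → f x ≤ -2) (hmax : ∀ x, IsLocalMax f x → 2 ≤ f x)
    {x : ℝ} (hx : x ∈ K) :
    Set.Icc (-2) 2 ⊆ f '' connectedComponentIn K x := by
  obtain ⟨y, hy, hy2⟩ := exists_le_neg_two_of_isLocalMin hf hK hcomp hfin hmin hx
  obtain ⟨z, hz, hz2⟩ := exists_le_neg_two_of_isLocalMin (f := fun t => -f t) hf.neg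
    (by simpa using hK) hcomp hfin
    (fun t ht => by have := hmax t (by simpa using ht.neg); linarith) hx
  refine subset_trans ?_ (isPreconnected_connectedComponentIn.intermediate_value hy hz
    hf.continuousOn)
  exact Set.Icc_subset_Icc hy2 (by linarith)

/-- If the number of components is the degree of the polynomial and every component is mapped
onto `[-2, 2]`, then every component is mapped injectively. -/
theorem Polynomial.injOn_connectedComponentIn {D : ℝ[X]} (hdeg : 0 < D.natDegree) {K : Set ℝ}
    (hK : ∀ x, x ∈ K ↔ |D.eval x| ≤ 2)
    (hcard : {C : Set ℝ | ∃ x ∈ K, C = connectedComponentIn K x}.ncard = D.natDegree)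
    (hsurj : ∀ x ∈ K, Set.Icc (-2) 2 ⊆ (fun y => D.eval y) '' connectedComponentIn K x)
    (x : ℝ) : Set.InjOn (fun y => D.eval y) (connectedComponentIn K x) := by
  intro y hy z hz hyz
  by_contra hne
  have hyK := connectedComponentIn_subset K x hy
  have hxK : x ∈ K := connectedComponentIn_nonempty_iff.1 ⟨y, hy⟩
  set c := D.eval y with hc
  have hex : ∀ C : Set ℝ, ∃ t, C ∈ {C : Set ℝ | ∃ x ∈ K, C = connectedComponentIn K x} →
      t ∈ C ∧ D.eval t = c := by
    intro C
    by_cases h : C ∈ {C : Set ℝ | ∃ x ∈ K, C = connectedComponentIn K x}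
    · obtain ⟨w, hw, rfl⟩ := h
      obtain ⟨t, ht, htc⟩ := hsurj w hw (abs_le.1 ((hK y).1 hyK))
      exact ⟨t, fun _ => ⟨ht, htc⟩⟩
    · exact ⟨0, fun h' => absurd h' h⟩
  choose g hg using hex
  set F := {C : Set ℝ | ∃ x ∈ K, C = connectedComponentIn K x} with hF
  have huniq : ∀ C ∈ F, ∀ t ∈ C, C = connectedComponentIn K t := by
    rintro C ⟨w, hw, rfl⟩ t ht
    exact connectedComponentIn_eq ht
  have hinj : Set.InjOn g F := by
    intro C₁ h₁ C₂ h₂ h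
    rw [huniq C₁ h₁ _ (hg C₁ h₁).1, huniq C₂ h₂ _ (hg C₂ h₂).1, h]
  have hFfin : F.Finite := Set.finite_of_ncard_ne_zero (by omega)
  obtain ⟨u, hu, hug, huc⟩ : ∃ u ∈ connectedComponentIn K x,
      u ≠ g (connectedComponentIn K x) ∧ D.eval u = c := by
    by_cases h : y = g (connectedComponentIn K x)
    · exact ⟨z, hz, fun h' => hne (h.trans h'.symm), hyz.symm⟩
    · exact ⟨y, hy, h, rfl⟩
  have hunot : u ∉ g '' F := by
    rintro ⟨C, hC, hCu⟩
    apply hug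
    rw [← hCu, huniq C hC _ (hg C hC).1, hCu, connectedComponentIn_eq hu]
  have hne0 : D - Polynomial.C c ≠ 0 := by
    intro h
    rw [sub_eq_zero] at h
    rw [h, Polynomial.natDegree_C] at hdeg
    exact lt_irrefl _ hdeg
  have hsub : insert u (g '' F) ⊆ ((D - Polynomial.C c).roots.toFinset : Set ℝ) := by
    intro t ht
    rw [Finset.mem_coe, Multiset.mem_toFinset, Polynomial.mem_roots hne0, Polynomial.IsRoot,
      Polynomial.eval_sub, Polynomial.eval_C, sub_eq_zero]
    rcases ht with rfl | ⟨C, hC, rfl⟩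
    · exact huc
    · exact (hg C hC).2
  have h1 := Set.ncard_le_ncard hsub (Finset.finite_toSet _)
  rw [Set.ncard_insert_of_notMem hunot (hFfin.image g), hinj.ncard_image, hcard,
    Set.ncard_coe_finset] at h1
  have h2 := (D - Polynomial.C c).roots.toFinset_card_le.trans
    (Polynomial.card_roots' (D - Polynomial.C c))
  rw [Polynomial.natDegree_sub_C] at h2
  omega

/-- If `{|D| ≤ 2}` has `deg D` components and `D` has no local extremum with value in the
wrong range, then `D` is a bijection from the interior of each component onto `(-2, 2)`. -/
theorem Polynomial.bijOn_interior_connectedComponentIn {D : ℝ[X]} (hdeg : 0 < D.natDegree)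
    {K : Set ℝ} (hK : ∀ x, x ∈ K ↔ |D.eval x| ≤ 2)
    (hcard : {C : Set ℝ | ∃ x ∈ K, C = connectedComponentIn K x}.ncard = D.natDegree)
    (hmin : ∀ x, IsLocalMin (fun y => D.eval y) x → D.eval x ≤ -2)
    (hmax : ∀ x, IsLocalMax (fun y => D.eval y) x → 2 ≤ D.eval x)
    {x : ℝ} (hx : x ∈ K) :
    Set.BijOn (fun y => D.eval y) (interior (connectedComponentIn K x)) (Set.Ioo (-2) 2) := by
  have hcont : Continuous fun y => D.eval y := D.continuous
  have hKpre : K = (fun y => D.eval y) ⁻¹' Set.Icc (-2) 2 := by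
    ext y
    rw [hK, abs_le]
    rfl
  have hcomp : IsCompact K := by
    rw [hKpre]
    exact (D.isProperMap_eval (Polynomial.natDegree_pos_iff_degree_pos.1 hdeg)).isCompact_preimage
      isCompact_Icc
  have hfin : {C : Set ℝ | ∃ x ∈ K, C = connectedComponentIn K x}.Finite :=
    Set.finite_of_ncard_ne_zero (by omega)
  have hsurj : ∀ x ∈ K, Set.Icc (-2) 2 ⊆ (fun y => D.eval y) '' connectedComponentIn K x :=
    fun x hx => Icc_subset_image_connectedComponentIn hcont hK hcomp hfin hmin hmax hx
  have hinj := Polynomial.injOn_connectedComponentIn hdeg hK hcard hsurj x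
  refine ⟨?_, hinj.mono interior_subset, ?_⟩
  · intro y hy
    obtain ⟨l, u, hyl, hsub⟩ := mem_nhds_iff_exists_Ioo_subset.1 (mem_interior_iff_mem_nhds.1 hy)
    set s := (l + y) / 2 with hs
    set t := (y + u) / 2 with ht
    have hsy : s < y := by linarith [hyl.1]
    have hyt : y < t := by linarith [hyl.2]
    have hIcc : Set.Icc s t ⊆ connectedComponentIn K x := fun w hw =>
      hsub ⟨by linarith [hw.1, hyl.1], by linarith [hw.2, hyl.2]⟩
    have hb : ∀ w ∈ Set.Icc s t, -2 ≤ D.eval w ∧ D.eval w ≤ 2 := fun w hw =>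
      abs_le.1 ((hK w).1 (connectedComponentIn_subset K x (hIcc hw)))
    have hsm : s ∈ Set.Icc s t := ⟨le_rfl, by linarith⟩
    have htm : t ∈ Set.Icc s t := ⟨by linarith, le_rfl⟩
    have hym : y ∈ Set.Icc s t := ⟨hsy.le, hyt.le⟩
    rcases hcont.continuousOn.strictMonoOn_of_injOn_Icc' (hsy.trans hyt).le (hinj.mono hIcc)
      with hm | hm
    · exact ⟨(hb s hsm).1.trans_lt (hm hsm hym hsy), (hm hym htm hyt).trans_le (hb t htm).2⟩
    · exact ⟨(hb t htm).1.trans_lt (hm hym htm hyt), (hm hsm hym hsy).trans_le (hb s hsm).2⟩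
  · intro c hc
    obtain ⟨y, hy, rfl⟩ := hsurj x hx ⟨hc.1.le, hc.2.le⟩
    refine ⟨y, ?_, rfl⟩
    have hKn : K ∈ nhds y := by
      rw [hKpre]
      exact hcont.continuousAt.preimage_mem_nhds (Icc_mem_nhds hc.1 hc.2)
    rw [mem_interior_iff_mem_nhds, connectedComponentIn_eq hy]
    exact connectedComponentIn_mem_nhds hKn

/-! ### Orthonormal polynomials -/

section Recursion

variable {a b : ℕ → ℝ} {P : ℕ → Polynomial ℝ}

theorem oprl_wronskian_pos (ha : ∀ n, 1 ≤ n → 0 < a n) (hP0 : P 0 = 1)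
    (hPrec0 : (X : Polynomial ℝ) * P 0 = a 1 • P 1 + b 1 • P 0)
    (hPrec : ∀ n, 1 ≤ n →
      (X : Polynomial ℝ) * P n = a (n + 1) • P (n + 1) + b (n + 1) • P n + a n • P (n - 1))
    (n : ℕ) (x : ℝ) :
    0 < (P (n + 1)).derivative.eval x * (P n).eval x
      - (P n).derivative.eval x * (P (n + 1)).eval x := by
  suffices h : 0 < a (n + 1) * ((P (n + 1)).derivative.eval x * (P n).eval x
      - (P n).derivative.eval x * (P (n + 1)).eval x) from
    (mul_pos_iff_of_pos_left (ha (n + 1) (by omega))).1 h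
  induction n with
  | zero =>
    have h := congrArg (fun q => q.derivative.eval x) hPrec0
    simp [hP0] at h
    simp [hP0, ← h]
  | succ n ih =>
    have h1 := congrArg (fun q => q.eval x) (hPrec (n + 1) (by omega))
    have h2 := congrArg (fun q => q.derivative.eval x) (hPrec (n + 1) (by omega))
    simp at h1 h2
    have h3 : a (n + 1 + 1) * ((P (n + 1 + 1)).derivative.eval x * (P (n + 1)).eval x
        - (P (n + 1)).derivative.eval x * (P (n + 1 + 1)).eval x)
        = (P (n + 1)).eval x ^ 2 + a (n + 1) * ((P (n + 1)).derivative.eval x * (P n).eval x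
          - (P n).derivative.eval x * (P (n + 1)).eval x) := by
      linear_combination (P (n + 1)).derivative.eval x * h1 - (P (n + 1)).eval x * h2
    rw [h3]
    positivity

theorem oprl_im_eq_zero_of_aeval_eq_zero (hP0 : P 0 = 1)
    (hPrec0 : (X : Polynomial ℝ) * P 0 = a 1 • P 1 + b 1 • P 0)
    (hPrec : ∀ n, 1 ≤ n →
      (X : Polynomial ℝ) * P n = a (n + 1) • P (n + 1) + b (n + 1) • P n + a n • P (n - 1))
    (n : ℕ) (w : ℂ) (hw : Polynomial.aeval w (P n) = 0) : w.im = 0 := by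
  have key : ∀ n, ∃ s : ℝ, 0 < s ∧
      a (n + 1) * ((Polynomial.aeval w (P (n + 1))).im * (Polynomial.aeval w (P n)).re
        - (Polynomial.aeval w (P (n + 1))).re * (Polynomial.aeval w (P n)).im) = w.im * s := by
    intro n
    induction n with
    | zero =>
      have h := congrArg (fun q => (Polynomial.aeval w q).im) hPrec0
      simp [hP0] at h
      exact ⟨1, one_pos, by simp [hP0, ← h]⟩
    | succ n ih =>
      obtain ⟨s, hs, h⟩ := ih
      have h1 := congrArg (fun q => (Polynomial.aeval w q).im) (hPrec (n + 1) (by omega))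
      have h2 := congrArg (fun q => (Polynomial.aeval w q).re) (hPrec (n + 1) (by omega))
      simp at h1 h2
      refine ⟨s + (Polynomial.aeval w (P (n + 1))).re ^ 2
        + (Polynomial.aeval w (P (n + 1))).im ^ 2, by positivity, ?_⟩
      linear_combination h - (Polynomial.aeval w (P (n + 1))).re * h1
        + (Polynomial.aeval w (P (n + 1))).im * h2
  cases n with
  | zero => simp [hP0] at hw
  | succ n =>
    obtain ⟨s, hs, h⟩ := key n
    rw [hw] at h
    simpa [hs.ne'] using h.symm

theorem oprl_degree (ha : ∀ n, 1 ≤ n → 0 < a n) (hP0 : P 0 = 1)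
    (hPrec0 : (X : Polynomial ℝ) * P 0 = a 1 • P 1 + b 1 • P 0)
    (hPrec : ∀ n, 1 ≤ n →
      (X : Polynomial ℝ) * P n = a (n + 1) • P (n + 1) + b (n + 1) • P n + a n • P (n - 1))
    (n : ℕ) : (P n).degree = n := by
  have hstep : ∀ n, (P n).degree = n → (∃ R : ℝ[X], R.degree < n + 1 ∧
      (X : Polynomial ℝ) * P n = a (n + 1) • P (n + 1) + R) →
      (P (n + 1)).degree = (n + 1 : ℕ) := by
    rintro n hn ⟨R, hR, h⟩
    have hX : ((X : Polynomial ℝ) * P n).degree = n + 1 := by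
      rw [Polynomial.degree_mul, hn, Polynomial.degree_X, add_comm]
    have h1 : a (n + 1) • P (n + 1) = X * P n - R := by rw [h]; ring
    have h2 := congrArg Polynomial.degree h1
    rw [Polynomial.degree_sub_eq_left_of_degree_lt (by rw [hX]; exact hR), hX,
      Polynomial.smul_eq_C_mul, Polynomial.degree_C_mul (ha (n + 1) (by omega)).ne'] at h2
    rw [h2]
    push_cast
    rfl
  induction n using Nat.strong_induction_on with
  | _ n ih =>
    rcases n with _ | _ | n
    · simp [hP0]
    · refine hstep 0 (by simp [hP0]) ⟨b 1 • P 0, ?_, hPrec0⟩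
      refine (Polynomial.degree_smul_le _ _).trans_lt ?_
      simp [hP0]
    · refine hstep (n + 1) (ih _ (by omega))
        ⟨b (n + 2) • P (n + 1) + a (n + 1) • P n, ?_, ?_⟩
      · refine (Polynomial.degree_add_le _ _).trans_lt (max_lt ?_ ?_)
        · refine (Polynomial.degree_smul_le _ _).trans_lt ?_
          rw [ih (n + 1) (by omega)]
          norm_cast
          omega
        · refine (Polynomial.degree_smul_le _ _).trans_lt ?_
          rw [ih n (by omega)]
          norm_cast
          omega
      · rw [hPrec (n + 1) (by omega), add_assoc]
        simp

end Recursion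

/-! ### Transfer matrices -/

theorem JacobiT_succ_zero (a b : ℕ → ℝ) (n : ℕ) (x : ℝ) (j : Fin 2) :
    JacobiT a b (n + 1) x 0 j = (a (n + 1))⁻¹ *
      ((x - b (n + 1)) * JacobiT a b n x 0 j - a n * JacobiT a b n x 1 j) := by
  simp [JacobiT, JacobiA, Matrix.mul_apply, Fin.sum_univ_two]
  ring

theorem JacobiT_succ_one {a : ℕ → ℝ} (b : ℕ → ℝ) {n : ℕ} (ha : a (n + 1) ≠ 0) (x : ℝ)
    (j : Fin 2) : JacobiT a b (n + 1) x 1 j = JacobiT a b n x 0 j := by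
  simp [JacobiT, JacobiA, Matrix.mul_apply, Fin.sum_univ_two, ha]

theorem JacobiT_det {a : ℕ → ℝ} (b : ℕ → ℝ) (ha : ∀ n, 1 ≤ n → 0 < a n) (n : ℕ) (x : ℝ) :
    a n * (JacobiT a b n x).det = a 0 := by
  induction n with
  | zero => simp [JacobiT]
  | succ n ih =>
    have h := (ha (n + 1) (by omega)).ne'
    rw [← ih, JacobiT, Matrix.det_mul, JacobiA, Matrix.det_smul, Matrix.det_fin_two_of]
    simp
    field_simp

theorem JacobiT_zero_zero {a b : ℕ → ℝ} {P : ℕ → Polynomial ℝ}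
    (ha : ∀ n, 1 ≤ n → 0 < a n) (hP0 : P 0 = 1)
    (hPrec0 : (X : Polynomial ℝ) * P 0 = a 1 • P 1 + b 1 • P 0)
    (hPrec : ∀ n, 1 ≤ n →
      (X : Polynomial ℝ) * P n = a (n + 1) • P (n + 1) + b (n + 1) • P n + a n • P (n - 1))
    (n : ℕ) (x : ℝ) : JacobiT a b n x 0 0 = (P n).eval x := by
  induction n using Nat.strong_induction_on with
  | _ n ih =>
    rcases n with _ | _ | n
    · simp [JacobiT, hP0]
    · have h := congrArg (fun q => q.eval x) hPrec0
      simp [hP0] at h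
      rw [JacobiT_succ_zero, inv_mul_eq_iff_eq_mul₀ (ha 1 le_rfl).ne']
      simp [JacobiT]
      linarith
    · have h := congrArg (fun q => q.eval x) (hPrec (n + 1) (by omega))
      simp at h
      rw [JacobiT_succ_zero, inv_mul_eq_iff_eq_mul₀ (ha (n + 2) (by omega)).ne',
        JacobiT_succ_one b (ha (n + 1) (by omega)).ne', ih n (by omega), ih (n + 1) (by omega)]
      linarith

theorem JacobiT_second_kind {a : ℕ → ℝ} (b : ℕ → ℝ) (ha : ∀ n, 1 ≤ n → 0 < a n) (n : ℕ) :
    ∃ q r : ℝ[X], q.natDegree ≤ n ∧ r.natDegree ≤ n ∧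
      (∀ x, JacobiT a b (n + 1) x 0 1 = q.eval x) ∧
      ∀ x, JacobiT a b (n + 1) x 1 1 = r.eval x := by
  induction n with
  | zero =>
    refine ⟨Polynomial.C (-((a 1)⁻¹ * a 0)), 0, (Polynomial.natDegree_C _).le, by simp,
      fun x => ?_, fun x => ?_⟩
    · rw [JacobiT_succ_zero]
      simp [JacobiT]
    · rw [JacobiT_succ_one b (ha 1 le_rfl).ne']
      simp [JacobiT]
  | succ n ih =>
    obtain ⟨q, r, hq, hr, hqe, hre⟩ := ih
    refine ⟨Polynomial.C (a (n + 2))⁻¹ * ((Polynomial.X - Polynomial.C (b (n + 2))) * q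
      - Polynomial.C (a (n + 1)) * r), q, ?_, by omega, fun x => ?_, fun x => ?_⟩
    · refine (Polynomial.natDegree_C_mul_le _ _).trans ?_
      refine (Polynomial.natDegree_sub_le _ _).trans (max_le ?_ ?_)
      · refine Polynomial.natDegree_mul_le.trans ?_
        rw [Polynomial.natDegree_X_sub_C]
        omega
      · exact (Polynomial.natDegree_C_mul_le _ _).trans (by omega)
    · rw [JacobiT_succ_zero, hqe, hre]
      simp
    · rw [JacobiT_succ_one b (ha (n + 2) (by omega)).ne', hqe]

theorem JacobiT_add_period {a b : ℕ → ℝ} {p : ℕ} (hpera : ∀ n, 1 ≤ n → a (n + p) = a n)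
    (hperb : ∀ n, 1 ≤ n → b (n + p) = b n) (ha0 : a 0 = a p) (n : ℕ) (x : ℝ) :
    JacobiT a b (n + p) x = JacobiT a b n x * JacobiT a b p x := by
  induction n with
  | zero => simp [JacobiT]
  | succ n ih =>
    have h : JacobiA a b (n + p) x = JacobiA a b n x := by
      have h1 : a (n + p) = a n := by
        rcases n with _ | n
        · rw [zero_add, ha0]
        · exact hpera _ (by omega)
      rw [JacobiA, JacobiA, show n + p + 1 = n + 1 + p by omega, hpera _ (by omega),
        hperb _ (by omega), h1]
    rw [show n + 1 + p = (n + p) + 1 by omega, JacobiT, JacobiT, ih, h, Matrix.mul_assoc]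

theorem JacobiT_mul_period {a b : ℕ → ℝ} {p : ℕ} (hpera : ∀ n, 1 ≤ n → a (n + p) = a n)
    (hperb : ∀ n, 1 ≤ n → b (n + p) = b n) (ha0 : a 0 = a p) (m : ℕ) (x : ℝ) :
    JacobiT a b (m * p) x = JacobiT a b p x ^ m := by
  induction m with
  | zero => simp [JacobiT]
  | succ m ih =>
    rw [Nat.succ_mul, JacobiT_add_period hpera hperb ha0, ih, pow_succ]

theorem Matrix.pow_succ_eq_chebyshev {M : Matrix (Fin 2) (Fin 2) ℝ} (hM : M.det = 1) (n : ℕ) :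
    M ^ (n + 1) = (Polynomial.Chebyshev.U ℝ n).eval (M.trace / 2) • M
      - (Polynomial.Chebyshev.U ℝ (n - 1)).eval (M.trace / 2) • 1 := by
  have hCH : M * M = M.trace • M - 1 := by
    rw [Matrix.det_fin_two] at hM
    ext i j
    fin_cases i <;> fin_cases j <;>
      simp [Matrix.mul_apply, Fin.sum_univ_two, Matrix.trace_fin_two] <;> linarith
  induction n with
  | zero => simp
  | succ n ih =>
    have hU : (Polynomial.Chebyshev.U ℝ (n + 1 : ℤ)).eval (M.trace / 2)
        = M.trace * (Polynomial.Chebyshev.U ℝ n).eval (M.trace / 2)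
          - (Polynomial.Chebyshev.U ℝ (n - 1)).eval (M.trace / 2) := by
      rw [Polynomial.Chebyshev.U_add_one]
      simp only [Polynomial.eval_sub, Polynomial.eval_mul, Polynomial.eval_X,
        Polynomial.eval_ofNat]
      ring
    rw [pow_succ, ih, sub_mul, smul_mul_assoc, hCH, smul_mul_assoc, one_mul]
    push_cast
    rw [hU, add_sub_cancel_right]
    module

/-! ### Zeros of Chebyshev polynomials of the second kind -/

theorem Polynomial.Chebyshev.exists_U_eval_eq_zero_of_lt_one {c : ℝ} (hc : c < 1) :
    ∃ (n : ℕ) (y : ℝ), c < y ∧ (Polynomial.Chebyshev.U ℝ n).eval y = 0 := by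
  have hlim : Filter.Tendsto (fun n : ℕ => Real.cos (Real.pi / ((n : ℝ) + 1))) Filter.atTop
      (nhds 1) := by
    have h : Filter.Tendsto (fun n : ℕ => Real.pi / ((n : ℝ) + 1)) Filter.atTop (nhds 0) :=
      tendsto_const_nhds.div_atTop
        (Filter.tendsto_atTop_add_const_right _ _ tendsto_natCast_atTop_atTop)
    simpa [Function.comp_def] using (Real.continuous_cos.tendsto 0).comp h
  obtain ⟨n, hn, hn1⟩ := ((hlim.eventually (lt_mem_nhds hc)).and
    (Filter.eventually_ge_atTop 1)).exists
  refine ⟨n, _, hn, ?_⟩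
  have hn1' : (1 : ℝ) ≤ n := by exact_mod_cast hn1
  have hU := Polynomial.Chebyshev.U_real_cos (Real.pi / ((n : ℝ) + 1)) n
  rw [show (((n : ℤ) : ℝ) + 1) * (Real.pi / ((n : ℝ) + 1)) = Real.pi by
    push_cast; field_simp, Real.sin_pi] at hU
  refine (mul_eq_zero.1 hU).resolve_right (Real.sin_pos_of_pos_of_lt_pi (by positivity) ?_).ne'
  rw [div_lt_iff₀ (by positivity)]
  nlinarith [Real.pi_pos]

theorem Polynomial.Chebyshev.exists_U_eval_eq_zero_of_neg_one_lt {c : ℝ} (hc : -1 < c) :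
    ∃ (n : ℕ) (y : ℝ), y < c ∧ (Polynomial.Chebyshev.U ℝ n).eval y = 0 := by
  obtain ⟨n, y, hy, h⟩ := Polynomial.Chebyshev.exists_U_eval_eq_zero_of_lt_one
    (c := -c) (by linarith)
  exact ⟨n, -y, by linarith, by rw [Polynomial.Chebyshev.U_eval_neg, h, mul_zero]⟩

theorem Polynomial.Chebyshev.ncard_U_zeros (n : ℕ) :
    {y ∈ Set.Ioo (-1 : ℝ) 1 | (Polynomial.Chebyshev.U ℝ n).eval y = 0}.ncard = n := by
  have hne : Polynomial.Chebyshev.U ℝ n ≠ 0 := by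
    intro h
    have := Polynomial.Chebyshev.U_eval_one (R := ℝ) n
    rw [h] at this
    simp at this
    norm_cast at this
  set s := (Finset.range n).image
    (fun (k : ℕ) => Real.cos ((k + 1) * Real.pi / (n + 1))) with hs
  have hroots := Polynomial.Chebyshev.roots_U_real n
  have hset : {y ∈ Set.Ioo (-1 : ℝ) 1 | (Polynomial.Chebyshev.U ℝ n).eval y = 0} = s := by
    ext y
    have hiff : (Polynomial.Chebyshev.U ℝ n).eval y = 0 ↔ y ∈ s := by
      rw [← Finset.mem_val, hs, ← hroots, Polynomial.mem_roots hne]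
      rfl
    refine ⟨fun h => hiff.1 h.2, fun h => ⟨?_, hiff.2 h⟩⟩
    obtain ⟨k, hk, rfl⟩ := Finset.mem_image.1 (Finset.mem_coe.1 h)
    have hk' : (k : ℝ) + 1 ≤ n := by exact_mod_cast Finset.mem_range.1 hk
    have hsin : 0 < Real.sin ((k + 1) * Real.pi / (n + 1)) := by
      apply Real.sin_pos_of_pos_of_lt_pi (by positivity)
      rw [div_lt_iff₀ (by positivity)]
      nlinarith [Real.pi_pos]
    have := Real.sin_sq_add_cos_sq ((k + 1) * Real.pi / (n + 1))
    constructor <;> nlinarith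
  rw [hset, Set.ncard_coe_finset, hs, Finset.card_image_of_injOn, Finset.card_range]
  exact (Finset.range n).nodup_map_iff_injOn.mp (Polynomial.Chebyshev.roots_U_real_nodup n)

theorem Polynomial.sub_C_dvd_comp_of_isRoot {U D : ℝ[X]} {y : ℝ} (hy : U.eval y = 0) :
    D - Polynomial.C (2 * y) ∣ U.comp (Polynomial.C (1 / 2) * D) := by
  obtain ⟨V, rfl⟩ := Polynomial.dvd_iff_isRoot.2 hy
  refine ⟨Polynomial.C (1 / 2) * V.comp (Polynomial.C (1 / 2) * D), ?_⟩
  have h2 : (Polynomial.C y : ℝ[X]) = Polynomial.C (2 * y) * Polynomial.C (1 / 2) := by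
    rw [← Polynomial.C_mul]
    congr 1
    ring
  rw [Polynomial.mul_comp, Polynomial.sub_comp, Polynomial.X_comp, Polynomial.C_comp, h2]
  ring

/-! ### Discriminant and zero counts -/

theorem exists_discriminant_polynomial {a b : ℕ → ℝ} {P : ℕ → Polynomial ℝ} {p : ℕ} (hp : 1 ≤ p)
    (ha : ∀ n, 1 ≤ n → 0 < a n) (hP0 : P 0 = 1)
    (hPrec0 : (X : Polynomial ℝ) * P 0 = a 1 • P 1 + b 1 • P 0)
    (hPrec : ∀ n, 1 ≤ n →
      (X : Polynomial ℝ) * P n = a (n + 1) • P (n + 1) + b (n + 1) • P n + a n • P (n - 1)) :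
    ∃ D : ℝ[X], D.natDegree = p ∧ ∀ x, JacobiDisc a b p x = D.eval x := by
  obtain ⟨k, rfl⟩ := Nat.exists_eq_add_of_le' hp
  obtain ⟨-, r, -, hr, -, hre⟩ := JacobiT_second_kind b ha k
  have hdeg : (P (k + 1)).natDegree = k + 1 :=
    Polynomial.natDegree_eq_of_degree_eq_some (oprl_degree ha hP0 hPrec0 hPrec (k + 1))
  refine ⟨P (k + 1) + r, ?_, fun x => ?_⟩
  · rw [Polynomial.natDegree_add_eq_left_of_natDegree_lt (by omega), hdeg]
  · rw [JacobiDisc, Matrix.trace_fin_two, JacobiT_zero_zero ha hP0 hPrec0 hPrec, hre,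
      Polynomial.eval_add]

/-- At the end of a period, `p_{(n+1)p-1}` factors through the discriminant. -/
theorem oprl_eval_end_of_period {a b : ℕ → ℝ} {P : ℕ → Polynomial ℝ} {p : ℕ} (hp : 1 ≤ p)
    (ha : ∀ n, 1 ≤ n → 0 < a n)
    (hpera : ∀ n, 1 ≤ n → a (n + p) = a n)
    (hperb : ∀ n, 1 ≤ n → b (n + p) = b n)
    (ha0 : a 0 = a p) (hP0 : P 0 = 1)
    (hPrec0 : (X : Polynomial ℝ) * P 0 = a 1 • P 1 + b 1 • P 0)
    (hPrec : ∀ n, 1 ≤ n →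
      (X : Polynomial ℝ) * P n = a (n + 1) • P (n + 1) + b (n + 1) • P n + a n • P (n - 1))
    (n : ℕ) (x : ℝ) :
    (P ((n + 1) * p - 1)).eval x
      = (Polynomial.Chebyshev.U ℝ n).eval (JacobiDisc a b p x / 2) * (P (p - 1)).eval x := by
  have hT : ∀ j, 1 ≤ j → JacobiT a b j x 1 0 = (P (j - 1)).eval x := by
    intro j hj
    obtain ⟨k, rfl⟩ := Nat.exists_eq_add_of_le' hj
    rw [JacobiT_succ_one b (ha _ (by omega)).ne', JacobiT_zero_zero ha hP0 hPrec0 hPrec]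
    simp
  have hdet : (JacobiT a b p x).det = 1 := by
    have h := JacobiT_det b ha p x
    rw [ha0] at h
    exact mul_left_cancel₀ (ha p hp).ne' (h.trans (mul_one _).symm)
  rw [← hT _ (Nat.mul_pos n.succ_pos hp), ← hT p hp, JacobiT_mul_period hpera hperb ha0,
    Matrix.pow_succ_eq_chebyshev hdet]
  simp [JacobiDisc]

theorem two_le_abs_JacobiDisc {a b : ℕ → ℝ} {P : ℕ → Polynomial ℝ} {p : ℕ} (hp : 1 ≤ p)
    (ha : ∀ n, 1 ≤ n → 0 < a n) (ha0 : a 0 = a p) (hP0 : P 0 = 1)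
    (hPrec0 : (X : Polynomial ℝ) * P 0 = a 1 • P 1 + b 1 • P 0)
    (hPrec : ∀ n, 1 ≤ n →
      (X : Polynomial ℝ) * P n = a (n + 1) • P (n + 1) + b (n + 1) • P n + a n • P (n - 1))
    {x : ℝ} (hx : (P (p - 1)).eval x = 0) : 2 ≤ |JacobiDisc a b p x| := by
  obtain ⟨k, rfl⟩ := Nat.exists_eq_add_of_le' hp
  have h := JacobiT_det b ha (k + 1) x
  rw [ha0] at h
  have hdet := mul_left_cancel₀ (ha _ hp).ne' (h.trans (mul_one _).symm)
  have h10 : JacobiT a b (k + 1) x 1 0 = 0 := by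
    rw [JacobiT_succ_one b (ha _ (by omega)).ne', JacobiT_zero_zero ha hP0 hPrec0 hPrec]
    simpa using hx
  rw [Matrix.det_fin_two, h10, mul_zero, sub_zero] at hdet
  rw [JacobiDisc, Matrix.trace_fin_two]
  refine abs_le_of_sq_le_sq' ?_ (abs_nonneg _) |>.2
  rw [sq_abs]
  nlinarith [sq_nonneg (JacobiT a b (k + 1) x 0 0 - JacobiT a b (k + 1) x 1 1)]

theorem bijOn_interior_of_isBand {a b : ℕ → ℝ} {P : ℕ → Polynomial ℝ} {p : ℕ} (hp : 1 ≤ p)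
    (ha : ∀ n, 1 ≤ n → 0 < a n)
    (hpera : ∀ n, 1 ≤ n → a (n + p) = a n)
    (hperb : ∀ n, 1 ≤ n → b (n + p) = b n)
    (ha0 : a 0 = a p) (hP0 : P 0 = 1)
    (hPrec0 : (X : Polynomial ℝ) * P 0 = a 1 • P 1 + b 1 • P 0)
    (hPrec : ∀ n, 1 ≤ n →
      (X : Polynomial ℝ) * P n = a (n + 1) • P (n + 1) + b (n + 1) • P n + a n • P (n - 1))
    (hgaps : {C : Set ℝ | IsBand a b p C}.ncard = p) {B : Set ℝ} (hB : IsBand a b p B) :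
    Set.BijOn (JacobiDisc a b p) (interior B) (Set.Ioo (-2) 2) := by
  obtain ⟨D, hDdeg, hD⟩ := exists_discriminant_polynomial hp ha hP0 hPrec0 hPrec
  have hDpos : 0 < D.natDegree := by omega
  have hsplits : ∀ (n : ℕ) (y : ℝ), (Polynomial.Chebyshev.U ℝ n).eval y = 0 →
      (D - Polynomial.C (2 * y)).Splits := by
    intro n y hy
    have hfac : P ((n + 1) * p - 1)
        = (Polynomial.Chebyshev.U ℝ n).comp (Polynomial.C (1 / 2) * D) * P (p - 1) := by
      apply Polynomial.funext
      intro x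
      rw [oprl_eval_end_of_period hp ha hpera hperb ha0 hP0 hPrec0 hPrec, hD,
        Polynomial.eval_mul, Polynomial.eval_comp, Polynomial.eval_mul, Polynomial.eval_C,
        one_div_mul_eq_div]
    have hne : P ((n + 1) * p - 1) ≠ 0 := by
      intro h
      have := oprl_degree ha hP0 hPrec0 hPrec ((n + 1) * p - 1)
      rw [h] at this
      simp at this
    refine (Polynomial.splits_real_of_forall_im_eq_zero
      (oprl_im_eq_zero_of_aeval_eq_zero hP0 hPrec0 hPrec ((n + 1) * p - 1))).of_dvd hne ?_
    rw [hfac]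
    exact (Polynomial.sub_C_dvd_comp_of_isRoot hy).mul_right _
  have hmin : ∀ x, IsLocalMin (fun y => D.eval y) x → D.eval x ≤ -2 := by
    intro x hx
    by_contra! hlt
    obtain ⟨n, y, hy, hU⟩ := Polynomial.Chebyshev.exists_U_eval_eq_zero_of_neg_one_lt
      (c := D.eval x / 2) (by linarith)
    have := (hsplits n y hU).eval_nonpos_of_isLocalMin (x := x)
      (by rwa [Polynomial.natDegree_sub_C])
      (by filter_upwards [hx] with t ht; simpa using ht)
    simp at this
    linarith
  have hmax : ∀ x, IsLocalMax (fun y => D.eval y) x → 2 ≤ D.eval x := by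
    intro x hx
    by_contra! hlt
    obtain ⟨n, y, hy, hU⟩ := Polynomial.Chebyshev.exists_U_eval_eq_zero_of_lt_one
      (c := D.eval x / 2) (by linarith)
    have := (hsplits n y hU).neg.eval_nonpos_of_isLocalMin (x := x)
      (by rwa [Polynomial.natDegree_neg, Polynomial.natDegree_sub_C])
      (by
        filter_upwards [hx] with t ht
        simp only [Polynomial.eval_neg, Polynomial.eval_sub, Polynomial.eval_C]
        linarith)
    simp at this
    linarith
  have hK : ∀ x, x ∈ bandSet a b p ↔ |D.eval x| ≤ 2 := by
    intro x
    rw [abs_le, ← hD]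
    rfl
  obtain ⟨x, hx, rfl⟩ := hB
  rw [show JacobiDisc a b p = fun y => D.eval y from funext hD]
  exact Polynomial.bijOn_interior_connectedComponentIn hDpos hK (hgaps.trans hDdeg.symm)
    hmin hmax hx

theorem ncard_zeros_end_of_period {a b : ℕ → ℝ} {P : ℕ → Polynomial ℝ} {p : ℕ} (hp : 1 ≤ p)
    (ha : ∀ n, 1 ≤ n → 0 < a n)
    (hpera : ∀ n, 1 ≤ n → a (n + p) = a n)
    (hperb : ∀ n, 1 ≤ n → b (n + p) = b n)
    (ha0 : a 0 = a p) (hP0 : P 0 = 1)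
    (hPrec0 : (X : Polynomial ℝ) * P 0 = a 1 • P 1 + b 1 • P 0)
    (hPrec : ∀ n, 1 ≤ n →
      (X : Polynomial ℝ) * P n = a (n + 1) • P (n + 1) + b (n + 1) • P n + a n • P (n - 1))
    (hgaps : {C : Set ℝ | IsBand a b p C}.ncard = p) {B : Set ℝ} (hB : IsBand a b p B) (n : ℕ) :
    {x ∈ interior B | (P ((n + 1) * p - 1)).eval x = 0}.ncard = n := by
  have hbij := bijOn_interior_of_isBand hp ha hpera hperb ha0 hP0 hPrec0 hPrec hgaps hB
  have hzero : ∀ x ∈ interior B, (P ((n + 1) * p - 1)).eval x = 0 ↔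
      (Polynomial.Chebyshev.U ℝ n).eval (JacobiDisc a b p x / 2) = 0 := by
    intro x hx
    rw [oprl_eval_end_of_period hp ha hpera hperb ha0 hP0 hPrec0 hPrec, mul_eq_zero]
    refine or_iff_left fun h => ?_
    have h1 := two_le_abs_JacobiDisc hp ha ha0 hP0 hPrec0 hPrec h
    have h2 := hbij.mapsTo hx
    exact absurd (abs_lt.2 ⟨h2.1, h2.2⟩) (not_lt.2 h1)
  refine Eq.trans ?_ (Polynomial.Chebyshev.ncard_U_zeros n)
  refine Set.ncard_congr (fun x _ => JacobiDisc a b p x / 2) ?_ ?_ ?_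
  · rintro x ⟨hx, h⟩
    have h2 := hbij.mapsTo hx
    exact ⟨⟨by linarith [h2.1], by linarith [h2.2]⟩, (hzero x hx).1 h⟩
  · rintro x y ⟨hx, -⟩ ⟨hy, -⟩ h
    exact hbij.injOn hx hy (by linarith)
  · rintro y ⟨hy, h⟩
    obtain ⟨x, hx, hxy⟩ := hbij.surjOn (show 2 * y ∈ Set.Ioo (-2 : ℝ) 2 from
      ⟨by linarith [hy.1], by linarith [hy.2]⟩)
    have hx2 : JacobiDisc a b p x / 2 = y := by linarith
    exact ⟨x, ⟨hx, (hzero x hx).2 (by rw [hx2, h])⟩, hx2⟩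

theorem IsBand.ordConnected {a b : ℕ → ℝ} {p : ℕ} {B : Set ℝ} (hB : IsBand a b p B) :
    B.OrdConnected := by
  obtain ⟨x, -, rfl⟩ := hB
  exact isPreconnected_connectedComponentIn.ordConnected

/-- A sequence with increments at most one which equals `m` at `(m + 1) p - 1`
is close to `m` in between. -/
theorem abs_sub_le_of_interlacing {N : ℕ → ℕ} {p : ℕ} (hp : 1 ≤ p) (hN0 : N 0 = 0)
    (hstep : ∀ n, |(N (n + 1) : ℤ) - N n| ≤ 1) (hend : ∀ m, N ((m + 1) * p - 1) = m)
    {n m s : ℕ} (hn : n + 1 = m * p + s) (hs : s ≤ p) :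
    |(N n : ℤ) - (m - 1)| ≤ s ∧ |(N n : ℤ) - m| ≤ p - s := by
  have hd : ∀ n d : ℕ, |(N (n + d) : ℤ) - N n| ≤ d := by
    intro n d
    induction d with
    | zero => simp
    | succ d ih =>
      have := hstep (n + d)
      rw [abs_le] at *
      rw [← add_assoc]
      push_cast
      omega
  constructor
  · rcases m with _ | m
    · have h := hd 0 n
      rw [hN0, zero_add, abs_le] at h
      rw [abs_le]
      push_cast at *
      omega
    · have hpos : 1 ≤ (m + 1) * p := Nat.mul_pos m.succ_pos hp
      have h := hd ((m + 1) * p - 1) s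
      rw [hend, show (m + 1) * p - 1 + s = n by omega] at h
      push_cast
      simpa using h
  · have h := hd n (p - s)
    rw [show n + (p - s) = (m + 1) * p - 1 by rw [add_mul]; omega, hend] at h
    rw [abs_sub_comm]
    push_cast [hs] at h
    exact h

/-- **Theorem 2.3.** Assume all gaps are open (the band set has exactly `p` connected
components).  If `N⁽ⁿ⁾` is the number of zeros of `p_n` in the interior of a band `B`,
then `|N^{(mp+r)} - (m-1)| ≤ min(r+1, p-r)` for `-1 ≤ r ≤ p-1`, and
`|N⁽ⁿ⁾ - n/p| ≤ 1 + p/2`. -/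
theorem oprl_periodic_band_zero_count
    (p : ℕ) (hp : 1 ≤ p) (a b : ℕ → ℝ)
    (ha : ∀ n, 1 ≤ n → 0 < a n)
    (hpera : ∀ n, 1 ≤ n → a (n + p) = a n)
    (hperb : ∀ n, 1 ≤ n → b (n + p) = b n)
    (ha0 : a 0 = a p)
    (P : ℕ → Polynomial ℝ)
    (hP0 : P 0 = 1)
    (hPrec0 : (X : Polynomial ℝ) * P 0 = a 1 • P 1 + b 1 • P 0)
    (hPrec : ∀ n, 1 ≤ n →
      (X : Polynomial ℝ) * P n = a (n + 1) • P (n + 1) + b (n + 1) • P n + a n • P (n - 1))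
    (hgaps : {C : Set ℝ | IsBand a b p C}.ncard = p)
    (B : Set ℝ) (hB : IsBand a b p B)
    (N : ℕ → ℕ)
    (hN : ∀ n, N n = {x ∈ interior B | (P n).eval x = 0}.ncard) :
    (∀ m : ℕ, 1 ≤ m → ∀ r : ℤ, -1 ≤ r → r ≤ (p : ℤ) - 1 →
        |(N ((m * p : ℤ) + r).toNat : ℤ) - ((m : ℤ) - 1)| ≤ min (r + 1) ((p : ℤ) - r)) ∧
      (∀ n : ℕ, 1 ≤ n → |(N n : ℝ) - (n : ℝ) / (p : ℝ)| ≤ 1 + (p : ℝ) / 2) := by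
  have hfam : ∀ n x, (P (n + 1)).derivative.eval x * (P n).eval x
      - (P n).derivative.eval x * (P (n + 1)).eval x ≠ 0 := fun n x =>
    (oprl_wronskian_pos ha hP0 hPrec0 hPrec n x).ne'
  have hne : ∀ n, P n ≠ 0 := by
    intro n h
    have := oprl_degree ha hP0 hPrec0 hPrec n
    rw [h] at this
    simp at this
  have hI := hB.ordConnected.interior
  have hstep : ∀ n, |(N (n + 1) : ℤ) - N n| ≤ 1 := by
    intro n
    have h1 := Polynomial.ncard_zeros_le_of_wronskian_ne_zero hI (hne (n + 1)) (hne n) (hfam n)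
    have h2 := Polynomial.ncard_zeros_le_of_wronskian_ne_zero hI (hne n) (hne (n + 1))
      fun x h => hfam n x (by linarith)
    rw [← hN, ← hN] at h1 h2
    rw [abs_le]
    omega
  have hN0 : N 0 = 0 := by
    rw [hN, hP0]
    simp
  have hend : ∀ m, N ((m + 1) * p - 1) = m := fun m => by
    rw [hN, ncard_zeros_end_of_period hp ha hpera hperb ha0 hP0 hPrec0 hPrec hgaps hB]
  refine ⟨fun m hm r hr1 hr2 => ?_, fun n _ => ?_⟩
  · have hmp : (1 : ℤ) ≤ m * p := by exact_mod_cast Nat.mul_pos hm hp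
    obtain ⟨s, hs⟩ := Int.eq_ofNat_of_zero_le (show 0 ≤ r + 1 by omega)
    obtain ⟨h1, h2⟩ := abs_sub_le_of_interlacing hp hN0 hstep hend
      (n := ((m * p : ℤ) + r).toNat) (m := m) (s := s) (by zify; omega) (by omega)
    rw [abs_le] at h1 h2
    rw [le_min_iff, abs_le, abs_le]
    omega
  · obtain ⟨h1, h2⟩ := abs_sub_le_of_interlacing hp hN0 hstep hend
      (n := n) (m := (n + 1) / p) (s := (n + 1) % p) (Nat.div_add_mod' (n + 1) p).symm
      (Nat.mod_lt _ hp).le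
    have hn := Nat.div_add_mod' (n + 1) p
    have hsp := Nat.mod_lt (n + 1) hp
    generalize (n + 1) / p = m at *
    generalize (n + 1) % p = s at *
    rw [abs_le] at h1 h2
    have hp' : (1 : ℝ) ≤ p := by exact_mod_cast hp
    have hn' : (m : ℝ) * p + s = n + 1 := by exact_mod_cast hn
    have hs0 : (0 : ℝ) ≤ s := Nat.cast_nonneg s
    have hsp' : (s : ℝ) + 1 ≤ p := by exact_mod_cast hsp
    have h1l : -(s : ℝ) ≤ N n - (m - 1) := by exact_mod_cast h1.1
    have h1u : (N n : ℝ) - (m - 1) ≤ s := by exact_mod_cast h1.2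
    have h2l : -((p : ℝ) - s) ≤ N n - m := by exact_mod_cast h2.1
    have h2u : (N n : ℝ) - m ≤ p - s := by exact_mod_cast h2.2
    have hdiv : (n : ℝ) / p = m + (s - 1) / p := by
      field_simp
      linarith
    rw [hdiv]
    have hq : ((s : ℝ) - 1) / p * p = s - 1 := by field_simp
    have hq1 : -1 ≤ ((s : ℝ) - 1) / p := by
      rw [le_div_iff₀ (by linarith)]
      linarith
    rw [abs_le]
    constructor
    · rcases le_total ((s : ℝ) - 1) (p / 2) with h | h
      · have : ((s : ℝ) - 1) / p ≤ 1 / 2 := by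
          rw [div_le_iff₀ (by linarith)]
          linarith
        linarith
      · have : ((s : ℝ) - 1) / p ≤ 1 := by
          rw [div_le_iff₀ (by linarith)]
          linarith
        linarith
    · linarith
end

section
/- Assume all gaps are open. For each r with 1 ≤ r ≤ p and each band B, there exist an integer D and an integer M such that for all m ≥ M, the number of zeros of p_{mp+r−1} in B is equal to m − D or to m − D + 1. In particular, for each band B, sup_{n ≥ 1} |n/p − N^{(n)}(B)| < ∞, where N^{(n)}(B) denotes the number of zeros of p_n in B. (Theorem 2.5, counting part, including eq. (2.49).) -/
open Polynomial Matrix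

theorem div_lt_div_of_wronskian_pos {u v : ℝ[X]} {x y : ℝ} (hxy : x < y)
    (hv : ∀ z ∈ Set.Icc x y, v.eval z ≠ 0)
    (hW : ∀ z ∈ Set.Icc x y,
      0 < v.eval z * u.derivative.eval z - v.derivative.eval z * u.eval z) :
    u.eval x / v.eval x < u.eval y / v.eval y := by
  refine strictMonoOn_of_deriv_pos (f := fun z => u.eval z / v.eval z) (convex_Icc x y)
    (u.continuous.continuousOn.div v.continuous.continuousOn hv) ?_
    (Set.left_mem_Icc.2 hxy.le) (Set.right_mem_Icc.2 hxy.le) hxy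
  intro z hz
  have hz' := interior_subset hz
  rw [((u.hasDerivAt z).fun_div (v.hasDerivAt z) (hv z hz')).deriv]
  have := hW z hz'
  have := hv z hz'
  refine div_pos ?_ (by positivity)
  linarith

theorem ncard_zeros_eq_succ_of_wronskian_pos {u v : ℝ[X]} {α β : ℝ} (hαβ : α < β)
    (hW : ∀ z ∈ Set.Icc α β,
      0 < v.eval z * u.derivative.eval z - v.derivative.eval z * u.eval z)
    (hα : 0 < u.eval α * v.eval α) (hβ : u.eval β * v.eval β < 0) :
    {x ∈ Set.Icc α β | v.eval x = 0}.ncard = {x ∈ Set.Icc α β | u.eval x = 0}.ncard + 1 := by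
  have hu0 : u ≠ 0 := by rintro rfl; simp at hα
  have hv0 : v ≠ 0 := by rintro rfl; simp at hα
  have hfin (f : ℝ[X]) (hf : f ≠ 0) : {x ∈ Set.Icc α β | f.eval x = 0}.Finite :=
    (finite_setOfPred_isRoot hf).subset fun x hx => hx.2
  have hUfin := hfin u hu0
  have hVfin := hfin v hv0
  have hle : hVfin.toFinset.card ≤ hUfin.toFinset.card + 1 := by
    refine Finset.card_le_of_interleaved fun x hx y hy hxy _ => ?_
    simp only [Set.Finite.mem_toFinset, Set.mem_ofPred_eq] at hx hy ⊢
    by_contra! hno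
    have hsub : Set.Icc x y ⊆ Set.Icc α β := Set.Icc_subset_Icc hx.1.1 hy.1.2
    have hune : ∀ z ∈ Set.Icc x y, (-u).eval z ≠ 0 := by
      intro z hz h
      have hWz := hW z (hsub hz)
      have hz0 : u.eval z = 0 := by simpa using h
      rcases hz.1.eq_or_lt with rfl | h1
      · simp [hx.2, hz0] at hWz
      rcases hz.2.eq_or_lt with rfl | h2
      · simp [hy.2, hz0] at hWz
      exact (hno z ⟨hsub hz, hz0⟩ h1).not_gt h2
    have := div_lt_div_of_wronskian_pos (u := v) hxy hune (by
      intro z hz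
      have := hW z (hsub hz)
      simp only [eval_neg, derivative_neg]
      linarith)
    simp [hx.2, hy.2] at this
  have hge : (insert α (insert β hUfin.toFinset)).card ≤ hVfin.toFinset.card + 1 := by
    refine Finset.card_le_of_interleaved fun x hx y hy hxy _ => ?_
    simp only [Finset.mem_insert, Set.Finite.mem_toFinset, Set.mem_ofPred_eq] at hx hy ⊢
    have hxI : x ∈ Set.Icc α β := by
      rcases hx with rfl | rfl | h
      exacts [⟨le_rfl, hαβ.le⟩, ⟨hαβ.le, le_rfl⟩, h.1]
    have hyI : y ∈ Set.Icc α β := by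
      rcases hy with rfl | rfl | h
      exacts [⟨le_rfl, hαβ.le⟩, ⟨hαβ.le, le_rfl⟩, h.1]
    by_contra! hno
    have hsub : Set.Icc x y ⊆ Set.Icc α β := Set.Icc_subset_Icc hxI.1 hyI.2
    have hzero {z : ℝ} (hz : z ∈ Set.Icc α β) (h : u.eval z = 0) : v.eval z ≠ 0 := by
      intro h'
      have := hW z hz
      simp [h, h'] at this
    have hxv : v.eval x ≠ 0 ∧ 0 ≤ u.eval x / v.eval x := by
      rcases hx with rfl | rfl | h
      · refine ⟨right_ne_zero_of_mul hα.ne', ?_⟩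
        rcases pos_and_pos_or_neg_and_neg_of_mul_pos hα with h | h
        · exact (div_pos h.1 h.2).le
        · exact (div_pos_of_neg_of_neg h.1 h.2).le
      · exact absurd hyI.2 hxy.not_ge
      · exact ⟨hzero hxI h.2, by simp [h.2]⟩
    have hyv : v.eval y ≠ 0 ∧ u.eval y / v.eval y ≤ 0 := by
      rcases hy with rfl | rfl | h
      · exact absurd hxI.1 hxy.not_ge
      · refine ⟨right_ne_zero_of_mul hβ.ne, ?_⟩
        rcases mul_neg_iff.1 hβ with h | h
        · exact (div_neg_of_pos_of_neg h.1 h.2).le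
        · exact (div_neg_of_neg_of_pos h.1 h.2).le
      · exact ⟨hzero hyI h.2, by simp [h.2]⟩
    have hvne : ∀ z ∈ Set.Icc x y, v.eval z ≠ 0 := by
      intro z hz h
      rcases hz.1.eq_or_lt with rfl | h1
      · exact hxv.1 h
      rcases hz.2.eq_or_lt with rfl | h2
      · exact hyv.1 h
      exact (hno z ⟨hsub hz, h⟩ h1).not_gt h2
    have := div_lt_div_of_wronskian_pos hxy hvne fun z hz => hW z (hsub hz)
    linarith [hxv.2, hyv.2]
  rw [Finset.card_insert_of_notMem, Finset.card_insert_of_notMem] at hge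
  · rw [Set.ncard_eq_toFinset_card _ hUfin, Set.ncard_eq_toFinset_card _ hVfin]
    omega
  · simp [left_ne_zero_of_mul hβ.ne]
  · simp [left_ne_zero_of_mul hα.ne', hαβ.ne]

theorem exists_pos_le_sq_add_sq {y : ℕ → ℝ} {t : ℝ} (ht : t ∈ Set.Icc (-2 : ℝ) 2)
    (hy : ∀ m, y (m + 2) = t * y (m + 1) - y m) (h0 : y 0 ≠ 0 ∨ y 1 ≠ 0) :
    ∃ c, 0 < c ∧ ∀ m, c ≤ y m ^ 2 + y (m + 1) ^ 2 := by
  obtain ⟨K, hK⟩ : ∃ K, K = y 0 ^ 2 + y 1 ^ 2 - t * y 0 * y 1 := ⟨_, rfl⟩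
  have hinv : ∀ m, y m ^ 2 + y (m + 1) ^ 2 - t * y m * y (m + 1) = K := by
    intro m
    induction m with
    | zero => simp [hK]
    | succ m ih => rw [hy m, ← ih]; ring
  have hnonneg : 0 ≤ K := by
    rw [hK]
    nlinarith [sq_nonneg (y 1 - y 0), sq_nonneg (y 1 + y 0), ht.1, ht.2]
  rcases hnonneg.eq_or_lt with hK0 | hK0
  · have ht4 : (4 - t ^ 2) * y 0 ^ 2 = 0 ∧ ∀ m, y (m + 1) = t / 2 * y m := by
      have h4 : 0 ≤ 4 - t ^ 2 := by nlinarith [ht.1, ht.2]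
      have key m : 4 * (y (m + 1) - t / 2 * y m) ^ 2 + (4 - t ^ 2) * y m ^ 2 = 0 := by
        linear_combination 4 * hinv m - 4 * hK0
      constructor
      · nlinarith [key 0, sq_nonneg (y (0 + 1) - t / 2 * y 0), mul_nonneg h4 (sq_nonneg (y 0))]
      · intro m
        have : (y (m + 1) - t / 2 * y m) ^ 2 = 0 := by
          nlinarith [key m, sq_nonneg (y (m + 1) - t / 2 * y m),
            mul_nonneg h4 (sq_nonneg (y m))]
        linarith [pow_eq_zero_iff (two_ne_zero) |>.1 this]
    have hy0 : y 0 ≠ 0 := by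
      intro h
      have h1 : y 1 = 0 := by simpa [h] using ht4.2 0
      exact h0.elim (· h) (· h1)
    have htt : t ^ 2 = 4 := by
      have := (mul_eq_zero.1 ht4.1).resolve_right (pow_ne_zero 2 hy0)
      linarith
    have hsq : ∀ m, y m ^ 2 = y 0 ^ 2 := by
      intro m
      induction m with
      | zero => rfl
      | succ m ih => rw [ht4.2 m, ← ih]; linear_combination y m ^ 2 / 4 * htt
    refine ⟨y 0 ^ 2, by positivity, fun m => ?_⟩
    rw [hsq m]
    exact le_add_of_nonneg_right (sq_nonneg _)
  · refine ⟨K / 2, by positivity, fun m => ?_⟩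
    rw [← hinv m]
    nlinarith [sq_nonneg (y (m + 1) - y m), sq_nonneg (y (m + 1) + y m), ht.1, ht.2]

theorem eventually_mul_succ_pos {y : ℕ → ℝ} (hy : ∀ m, y (m + 2) = 2 * y (m + 1) - y m)
    (h0 : y 0 ≠ 0 ∨ y 1 ≠ 0) : ∃ M, ∀ m ≥ M, 0 < y m * y (m + 1) := by
  obtain ⟨d, hd⟩ : ∃ d, d = y 1 - y 0 := ⟨_, rfl⟩
  have hstep : ∀ m, y (m + 1) = y m + d := by
    intro m
    induction m with
    | zero => simp [hd]
    | succ m ih => rw [hy m, ih]; ring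
  have hlin : ∀ m : ℕ, y m = y 0 + m * d := by
    intro m
    induction m with
    | zero => simp
    | succ m ih => rw [hstep, ih]; push_cast; ring
  by_cases hd0 : d = 0
  · refine ⟨0, fun m _ => ?_⟩
    have h1 : y 1 = y 0 := by linarith
    have : y 0 ≠ 0 := by rw [h1] at h0; simpa using h0
    rw [hlin m, hlin (m + 1), hd0]
    simpa only [mul_zero, add_zero] using mul_self_pos.2 this
  · have hd2 : 0 < d ^ 2 := by positivity
    obtain ⟨M, hM⟩ := exists_nat_gt (-(d * y 0) / d ^ 2)
    rw [div_lt_iff₀ hd2] at hM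
    have hpos : ∀ m ≥ M, 0 < d * y m := fun m hm => by
      have : (M : ℝ) * d ^ 2 ≤ m * d ^ 2 := by gcongr
      rw [hlin m]
      linarith
    refine ⟨M, fun m hm => ?_⟩
    have := mul_pos (hpos m hm) (hpos (m + 1) (by omega))
    have h' : d * y m * (d * y (m + 1)) = d ^ 2 * (y m * y (m + 1)) := by ring
    rw [h'] at this
    exact pos_of_mul_pos_right this hd2.le

theorem eventually_wronskian_pos {g : ℕ → ℝ[X]} {Δ : ℝ[X]} {s : Set ℝ} (hs : IsCompact s)
    (hrec : ∀ m, g (m + 2) = Δ * g (m + 1) - g m)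
    (h0 : ∀ x ∈ s, (g 0).eval x ≠ 0 ∨ (g 1).eval x ≠ 0)
    (hΔ : ∀ x ∈ s, Δ.eval x ∈ Set.Icc (-2 : ℝ) 2)
    (hΔ' : ∀ x ∈ s, Δ.derivative.eval x < 0) :
    ∃ M, ∀ m ≥ M, ∀ x ∈ s,
      0 < (g (m + 1)).eval x * (g m).derivative.eval x
        - (g (m + 1)).derivative.eval x * (g m).eval x := by
  let W : ℕ → ℝ[X] := fun m => g (m + 1) * (g m).derivative - (g (m + 1)).derivative * g m
  suffices h : ∃ M, ∀ m ≥ M, ∀ x ∈ s, 0 < (W m).eval x by simpa [W] using h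
  have hstep (m : ℕ) (x : ℝ) :
      (W (m + 1)).eval x = (W m).eval x - Δ.derivative.eval x * (g (m + 1)).eval x ^ 2 := by
    simp only [W, hrec m, derivative_sub, derivative_mul, eval_sub, eval_mul, eval_add]
    ring
  have hmono (x : ℝ) (hx : x ∈ s) : Monotone fun m => (W m).eval x := by
    refine monotone_nat_of_le_succ fun m => ?_
    rw [hstep]
    nlinarith [hΔ' x hx, sq_nonneg ((g (m + 1)).eval x)]
  have hpt (x : ℝ) (hx : x ∈ s) : ∃ m, 0 < (W m).eval x := by
    obtain ⟨c, hc, hcm⟩ := exists_pos_le_sq_add_sq (y := fun m => (g m).eval x) (hΔ x hx)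
      (fun m => by simp [hrec m]) (h0 x hx)
    have hδ := hΔ' x hx
    have hgrow (k : ℕ) :
        (W 0).eval x + k * (-Δ.derivative.eval x * c) ≤ (W (2 * k)).eval x := by
      induction k with
      | zero => simp
      | succ k ih =>
        rw [show 2 * (k + 1) = 2 * k + 1 + 1 by ring, hstep, hstep]
        have := mul_le_mul_of_nonneg_left (hcm (2 * k + 1)) (neg_pos.2 hδ).le
        push_cast
        linarith
    have hpos : 0 < -Δ.derivative.eval x * c := mul_pos (neg_pos.2 hδ) hc
    obtain ⟨k, hk⟩ := exists_nat_gt (-(W 0).eval x / (-Δ.derivative.eval x * c))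
    rw [div_lt_iff₀ hpos] at hk
    exact ⟨2 * k, by linarith [hgrow k]⟩
  obtain ⟨t, ht⟩ := hs.elim_finite_subcover (fun m => {x | 0 < (W m).eval x})
    (fun m => isOpen_lt continuous_const (W m).continuous)
    (fun x hx => Set.mem_iUnion.2 (hpt x hx))
  refine ⟨t.sup id, fun m hm x hx => ?_⟩
  obtain ⟨i, hi, hxi⟩ := Set.mem_iUnion₂.1 (ht hx)
  exact lt_of_lt_of_le hxi (hmono x hx ((Finset.le_sup (f := id) hi).trans hm))

theorem eventually_ncard_zeros_succ_of_derivative_neg {g : ℕ → ℝ[X]} {Δ : ℝ[X]} {α β : ℝ}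
    (hαβ : α < β) (hrec : ∀ m, g (m + 2) = Δ * g (m + 1) - g m)
    (h0 : ∀ x ∈ Set.Icc α β, (g 0).eval x ≠ 0 ∨ (g 1).eval x ≠ 0)
    (hΔ : ∀ x ∈ Set.Icc α β, Δ.eval x ∈ Set.Icc (-2 : ℝ) 2)
    (hΔ' : ∀ x ∈ Set.Icc α β, Δ.derivative.eval x < 0)
    (hα : Δ.eval α = 2) (hβ : Δ.eval β = -2) :
    ∃ M, ∀ m ≥ M, {x ∈ Set.Icc α β | (g (m + 1)).eval x = 0}.ncard =
      {x ∈ Set.Icc α β | (g m).eval x = 0}.ncard + 1 := by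
  obtain ⟨M₁, h₁⟩ := eventually_wronskian_pos isCompact_Icc hrec h0 hΔ hΔ'
  obtain ⟨M₂, h₂⟩ := eventually_mul_succ_pos (y := fun m => (g m).eval α)
    (fun m => by simp [hrec m, hα]) (h0 α (Set.left_mem_Icc.2 hαβ.le))
  obtain ⟨M₃, h₃⟩ := eventually_mul_succ_pos (y := fun m => (-1) ^ m * (g m).eval β)
    (fun m => by simp [hrec m, hβ]; ring) (by simpa using h0 β (Set.right_mem_Icc.2 hαβ.le))
  refine ⟨max M₁ (max M₂ M₃), fun m hm => ?_⟩
  simp only [ge_iff_le, max_le_iff] at hm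
  refine ncard_zeros_eq_succ_of_wronskian_pos hαβ (h₁ m hm.1) (h₂ m hm.2.1) ?_
  have h := h₃ m hm.2.2
  have hsq : ((-1 : ℝ) ^ m) ^ 2 = 1 := by rw [← pow_mul, mul_comm, pow_mul]; simp
  have heq : (-1) ^ m * (g m).eval β * ((-1) ^ (m + 1) * (g (m + 1)).eval β) =
      -((g m).eval β * (g (m + 1)).eval β) := by
    linear_combination -((g m).eval β * (g (m + 1)).eval β) * hsq
  rw [heq] at h
  linarith

theorem eventually_ncard_zeros_succ_of_derivative_pos {g : ℕ → ℝ[X]} {Δ : ℝ[X]} {α β : ℝ}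
    (hαβ : α < β) (hrec : ∀ m, g (m + 2) = Δ * g (m + 1) - g m)
    (h0 : ∀ x ∈ Set.Icc α β, (g 0).eval x ≠ 0 ∨ (g 1).eval x ≠ 0)
    (hΔ : ∀ x ∈ Set.Icc α β, Δ.eval x ∈ Set.Icc (-2 : ℝ) 2)
    (hΔ' : ∀ x ∈ Set.Icc α β, 0 < Δ.derivative.eval x)
    (hα : Δ.eval α = -2) (hβ : Δ.eval β = 2) :
    ∃ M, ∀ m ≥ M, {x ∈ Set.Icc α β | (g (m + 1)).eval x = 0}.ncard =
      {x ∈ Set.Icc α β | (g m).eval x = 0}.ncard + 1 := by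
  have h := eventually_ncard_zeros_succ_of_derivative_neg (g := fun m => (-1) ^ m * g m)
    (Δ := -Δ) hαβ (fun m => by simp only [hrec m]; ring) (by simpa using h0)
    (fun x hx => by
      have := hΔ x hx
      rw [eval_neg]
      constructor <;> linarith [this.1, this.2])
    (fun x hx => by simpa using hΔ' x hx) (by simp [hα]) (by simp [hβ])
  simpa using h

theorem exists_derivative_eq_zero_of_gap {Q : ℝ[X]} {x y z : ℝ}
    (hx : Q.eval x ∈ Set.Icc (-2 : ℝ) 2) (hy : Q.eval y ∈ Set.Icc (-2 : ℝ) 2)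
    (hz : z ∈ Set.Icc x y) (hzQ : Q.eval z ∉ Set.Icc (-2 : ℝ) 2) :
    ∃ w ∈ Set.Ioo x y, Q.derivative.eval w = 0 ∧ Q.eval w ∉ Set.Icc (-2 : ℝ) 2 := by
  have hsq (w : ℝ) : Q.eval w ∈ Set.Icc (-2 : ℝ) 2 ↔ (Q ^ 2).eval w ≤ 2 ^ 2 := by
    rw [eval_pow, sq_le_sq, abs_two, abs_le, Set.mem_Icc]
  rw [hsq] at hx hy hzQ
  obtain ⟨w, hw, hmax⟩ := isCompact_Icc.exists_isMaxOn ⟨z, hz⟩ (Q ^ 2).continuousOn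
  have hwQ : ¬ (Q ^ 2).eval w ≤ 2 ^ 2 := fun h => hzQ ((hmax hz).trans h)
  have hwI : w ∈ Set.Ioo x y := by
    refine ⟨lt_of_le_of_ne hw.1 ?_, lt_of_le_of_ne hw.2 ?_⟩
    · rintro rfl; exact hwQ hx
    · rintro rfl; exact hwQ hy
  refine ⟨w, hwI, ?_, by rwa [hsq]⟩
  have hd := (hmax.isLocalMax (Icc_mem_nhds hwI.1 hwI.2)).hasDerivAt_eq_zero
    ((Q ^ 2).hasDerivAt w)
  have hQw : Q.eval w ≠ 0 := by
    intro h
    simp [h] at hwQ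
  simpa [derivative_pow, hQw] using hd

theorem derivative_ne_zero_of_ncard_components {Q : ℝ[X]} {p : ℕ} (hp : 1 ≤ p)
    (hdeg : Q.natDegree = p) {S : Set ℝ} (hS : S = {x | Q.eval x ∈ Set.Icc (-2 : ℝ) 2})
    (hcard : {C : Set ℝ | ∃ x ∈ S, C = connectedComponentIn S x}.ncard = p)
    {x₀ : ℝ} (hx₀ : x₀ ∈ S) : Q.derivative.eval x₀ ≠ 0 := by
  intro hx₀'
  have hmem (x : ℝ) : x ∈ S ↔ Q.eval x ∈ Set.Icc (-2 : ℝ) 2 := by rw [hS]; rfl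
  have hfin : {C : Set ℝ | ∃ x ∈ S, C = connectedComponentIn S x}.Finite :=
    Set.finite_of_ncard_ne_zero (by omega)
  have hQ' : Q.derivative ≠ 0 := by
    intro h
    have := derivative_eq_zero.1 h
    omega
  choose! c hcS hc using fun (C : Set ℝ)
    (hC : C ∈ {C : Set ℝ | ∃ x ∈ S, C = connectedComponentIn S x}) => hC
  have hinj : Set.InjOn c {C : Set ℝ | ∃ x ∈ S, C = connectedComponentIn S x} := by
    intro C hC C' hC' h
    rw [hc C hC, hc C' hC', h]
  have hreps : (hfin.toFinset.image c).card = p := by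
    rw [Finset.card_image_of_injOn (by simpa using hinj), ← Set.ncard_eq_toFinset_card _ hfin,
      hcard]
  have hle : (hfin.toFinset.image c).card ≤ (Q.derivative.roots.toFinset.erase x₀).card + 1 := by
    refine Finset.card_le_of_interleaved fun x hx y hy hxy _ => ?_
    simp only [Finset.mem_image, Set.Finite.mem_toFinset] at hx hy
    obtain ⟨C, hC, rfl⟩ := hx
    obtain ⟨C', hC', rfl⟩ := hy
    have hgap : ∃ z ∈ Set.Icc (c C) (c C'), z ∉ S := by
      by_contra! hsub
      have h := isPreconnected_Icc.subset_connectedComponentIn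
        (Set.left_mem_Icc.2 hxy.le) hsub (Set.right_mem_Icc.2 hxy.le)
      have h' := connectedComponentIn_eq h
      rw [← hc C hC, ← hc C' hC'] at h'
      exact hxy.ne (congrArg c h')
    obtain ⟨z, hz, hzS⟩ := hgap
    rw [hmem] at hzS
    obtain ⟨w, hw, hw', hwS⟩ := exists_derivative_eq_zero_of_gap ((hmem _).1 (hcS C hC))
      ((hmem _).1 (hcS C' hC')) hz hzS
    refine ⟨w, ?_, hw.1, hw.2⟩
    rw [Finset.mem_erase, Multiset.mem_toFinset, mem_roots hQ']
    refine ⟨?_, hw'⟩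
    rintro rfl
    exact hwS ((hmem _).1 hx₀)
  have hroot : x₀ ∈ Q.derivative.roots.toFinset := by
    rw [Multiset.mem_toFinset, mem_roots hQ']
    exact hx₀'
  rw [Finset.card_erase_add_one hroot, hreps] at hle
  have h1 := Multiset.toFinset_card_le Q.derivative.roots
  have h2 := card_roots' Q.derivative
  have h3 := natDegree_derivative_lt (p := Q) (by omega)
  omega

theorem eventually_lt_of_derivative_neg {Q : ℝ[X]} {a : ℝ} (h : Q.derivative.eval a < 0) :
    ∀ᶠ x in nhds a, (x < a → Q.eval a < Q.eval x) ∧ (a < x → Q.eval x < Q.eval a) := by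
  have hs := eventually_nhdsWithin_sign_eq_of_deriv_neg (f := fun x => Q.eval x - Q.eval a)
    (x₀ := a) (by simpa using h) (sub_self _)
  filter_upwards [hs] with x hx
  constructor <;> intro hxa
  · rw [sign_pos (sub_pos.2 hxa), sign_eq_one_iff] at hx
    linarith
  · rw [sign_neg (sub_neg.2 hxa), sign_eq_neg_one_iff] at hx
    linarith

theorem eventually_lt_of_derivative_pos {Q : ℝ[X]} {a : ℝ} (h : 0 < Q.derivative.eval a) :
    ∀ᶠ x in nhds a, (x < a → Q.eval x < Q.eval a) ∧ (a < x → Q.eval a < Q.eval x) := by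
  simpa using eventually_lt_of_derivative_neg (Q := -Q) (a := a) (by simpa using h)

theorem connectedComponentIn_eq_Icc_of_derivative_ne_zero {Q : ℝ[X]} (hdeg : 0 < Q.degree)
    {S : Set ℝ} (hS : S = {x | Q.eval x ∈ Set.Icc (-2 : ℝ) 2})
    (hQ' : ∀ x ∈ S, Q.derivative.eval x ≠ 0) {x₀ : ℝ} (hx₀ : x₀ ∈ S) :
    ∃ α β, α < β ∧ connectedComponentIn S x₀ = Set.Icc α β ∧
      (((∀ x ∈ Set.Icc α β, Q.derivative.eval x < 0) ∧ Q.eval α = 2 ∧ Q.eval β = -2) ∨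
        ((∀ x ∈ Set.Icc α β, 0 < Q.derivative.eval x) ∧ Q.eval α = -2 ∧ Q.eval β = 2)) := by
  have hmem (x : ℝ) : x ∈ S ↔ Q.eval x ∈ Set.Icc (-2 : ℝ) 2 := by rw [hS]; rfl
  have hclosed : IsClosed S := by rw [hS]; exact isClosed_Icc.preimage Q.continuous
  have hcompact : IsCompact S := by
    have h := Q.tendsto_norm_atTop hdeg (tendsto_norm_cocompact_atTop (E := ℝ))
    have h2 := (h.eventually_gt_atTop 2)
    rw [Filter.Eventually, Filter.mem_cocompact] at h2
    obtain ⟨K, hK, hKs⟩ := h2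
    refine hK.of_isClosed_subset hclosed fun x hx => ?_
    by_contra hxK
    have h3 : 2 < |Q.eval x| := hKs hxK
    exact h3.not_ge (abs_le.2 ((hmem x).1 hx))
  have hCS := connectedComponentIn_subset S x₀
  have hxC := mem_connectedComponentIn hx₀
  have hconn : IsConnected (connectedComponentIn S x₀) := isConnected_connectedComponentIn_iff.2 hx₀
  have hCclosed : IsClosed (connectedComponentIn S x₀) := by
    refine closure_subset_iff_isClosed.1 ?_
    exact hconn.isPreconnected.closure.subset_connectedComponentIn (subset_closure hxC)
      (hclosed.closure_subset_iff.2 hCS)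
  have hIcc := eq_Icc_of_connected_compact hconn (hcompact.of_isClosed_subset hCclosed hCS)
  generalize sInf (connectedComponentIn S x₀) = α at hIcc
  generalize sSup (connectedComponentIn S x₀) = β at hIcc
  have hαβ : α ≤ β := by
    rw [hIcc] at hxC
    exact hxC.1.trans hxC.2
  have hαC : α ∈ Set.Icc α β := Set.left_mem_Icc.2 hαβ
  have hβC : β ∈ Set.Icc α β := Set.right_mem_Icc.2 hαβ
  have hIS : Set.Icc α β ⊆ S := hIcc ▸ hCS
  have hmax (u v : ℝ) (hu : u ≤ α) (hv : β ≤ v) (hsub : Set.Icc u v ⊆ S) : u = α ∧ v = β := by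
    have h : Set.Icc u v ⊆ Set.Icc α β := by
      rw [← hIcc]
      refine isPreconnected_Icc.subset_connectedComponentIn ?_ hsub
      rw [hIcc] at hxC
      exact ⟨hu.trans hxC.1, hxC.2.trans hv⟩
    have huv : u ≤ v := by linarith
    exact ⟨le_antisymm hu (h (Set.left_mem_Icc.2 huv)).1,
      le_antisymm (h (Set.right_mem_Icc.2 huv)).2 hv⟩
  have hleft : ¬ ∀ᶠ x in nhdsWithin α (Set.Iio α), x ∈ S := by
    intro h
    obtain ⟨u, hu, hsub⟩ := mem_nhdsLT_iff_exists_Ico_subset.1 h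
    have := hmax u β hu.le le_rfl fun x hx => by
      rcases lt_or_ge x α with h1 | h1
      · exact hsub ⟨hx.1, h1⟩
      · exact hIS ⟨h1, hx.2⟩
    exact hu.ne this.1
  have hright : ¬ ∀ᶠ x in nhdsWithin β (Set.Ioi β), x ∈ S := by
    intro h
    obtain ⟨v, hv, hsub⟩ := mem_nhdsGT_iff_exists_Ioc_subset.1 h
    have := hmax α v le_rfl hv.le fun x hx => by
      rcases le_or_gt x β with h1 | h1
      · exact hIS ⟨hx.1, h1⟩
      · exact hsub ⟨h1, hx.2⟩
    exact hv.ne' this.2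
  have hαQ := (hmem α).1 (hIS hαC)
  have hβQ := (hmem β).1 (hIS hβC)
  have hne : ∀ x ∈ Set.Icc α β, Q.derivative.eval x ≠ 0 := fun x hx => hQ' x (hIS hx)
  have hsign : (∀ x ∈ Set.Icc α β, Q.derivative.eval x < 0) ∨
      ∀ x ∈ Set.Icc α β, 0 < Q.derivative.eval x := by
    by_contra! h
    obtain ⟨⟨x, hx, hx0⟩, y, hy, hy0⟩ := h
    obtain ⟨z, hz, hz0⟩ := isPreconnected_Icc.intermediate_value hy hx
      Q.derivative.continuous.continuousOn ⟨hy0, hx0⟩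
    exact hne z hz hz0
  have hcont (a : ℝ) := Q.continuous.tendsto a
  rcases hsign with hsign | hsign
  · have hα : Q.eval α = 2 := by
      by_contra h
      refine hleft ?_
      filter_upwards [self_mem_nhdsWithin,
        nhdsWithin_le_nhds (eventually_lt_of_derivative_neg (hsign α hαC)),
        nhdsWithin_le_nhds ((hcont α).eventually_lt_const (lt_of_le_of_ne hαQ.2 h))]
        with x h1 h2 h3
      exact (hmem x).2 ⟨hαQ.1.trans (h2.1 h1).le, h3.le⟩
    have hβ : Q.eval β = -2 := by
      by_contra h
      refine hright ?_
      filter_upwards [self_mem_nhdsWithin,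
        nhdsWithin_le_nhds (eventually_lt_of_derivative_neg (hsign β hβC)),
        nhdsWithin_le_nhds ((hcont β).eventually_const_lt (lt_of_le_of_ne' hβQ.1 h))]
        with x h1 h2 h3
      exact (hmem x).2 ⟨h3.le, (h2.2 h1).le.trans hβQ.2⟩
    refine ⟨α, β, lt_of_le_of_ne hαβ ?_, hIcc, Or.inl ⟨hsign, hα, hβ⟩⟩
    rintro rfl
    linarith
  · have hα : Q.eval α = -2 := by
      by_contra h
      refine hleft ?_
      filter_upwards [self_mem_nhdsWithin,
        nhdsWithin_le_nhds (eventually_lt_of_derivative_pos (hsign α hαC)),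
        nhdsWithin_le_nhds ((hcont α).eventually_const_lt (lt_of_le_of_ne' hαQ.1 h))]
        with x h1 h2 h3
      exact (hmem x).2 ⟨h3.le, (h2.1 h1).le.trans hαQ.2⟩
    have hβ : Q.eval β = 2 := by
      by_contra h
      refine hright ?_
      filter_upwards [self_mem_nhdsWithin,
        nhdsWithin_le_nhds (eventually_lt_of_derivative_pos (hsign β hβC)),
        nhdsWithin_le_nhds ((hcont β).eventually_lt_const (lt_of_le_of_ne hβQ.2 h))]
        with x h1 h2 h3
      exact (hmem x).2 ⟨hβQ.1.trans (h2.2 h1).le, h3.le⟩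
    refine ⟨α, β, lt_of_le_of_ne hαβ ?_, hIcc, Or.inr ⟨hsign, hα, hβ⟩⟩
    rintro rfl
    linarith

theorem eventually_ncard_zeros_succ {f : ℕ → ℝ[X]} {Δ : ℝ[X]} {α β : ℝ}
    (hαβ : α < β) (hrec : ∀ m, f (m + 2) = Δ * f (m + 1) - f m)
    (hsimple : ∀ m x, (f m).eval x = 0 → (f m).derivative.eval x ≠ 0)
    (hΔ : ∀ x ∈ Set.Icc α β, Δ.eval x ∈ Set.Icc (-2 : ℝ) 2)
    (hedge : ((∀ x ∈ Set.Icc α β, Δ.derivative.eval x < 0) ∧ Δ.eval α = 2 ∧ Δ.eval β = -2) ∨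
      ((∀ x ∈ Set.Icc α β, 0 < Δ.derivative.eval x) ∧ Δ.eval α = -2 ∧ Δ.eval β = 2)) :
    ∃ M, ∀ m ≥ M, {x ∈ Set.Icc α β | (f (m + 1)).eval x = 0}.ncard =
      {x ∈ Set.Icc α β | (f m).eval x = 0}.ncard + 1 := by
  have hne (m : ℕ) : f m ≠ 0 := by
    intro h
    exact hsimple m 0 (by simp [h]) (by simp [h])
  obtain ⟨d, hd⟩ : ∃ d, d = EuclideanDomain.gcd (f 0) (f 1) := ⟨_, rfl⟩
  have hdvd (m : ℕ) : d ∣ f m := by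
    induction m using Nat.twoStepInduction with
    | zero => exact hd ▸ EuclideanDomain.gcd_dvd_left _ _
    | one => exact hd ▸ EuclideanDomain.gcd_dvd_right _ _
    | more m h₁ h₂ => exact hrec m ▸ dvd_sub (h₂.mul_left _) h₁
  choose g hg using hdvd
  have hd0 : d ≠ 0 := left_ne_zero_of_mul (hg 0 ▸ hne 0)
  have hg0 (m : ℕ) : g m ≠ 0 := right_ne_zero_of_mul (hg m ▸ hne m)
  have hgrec (m : ℕ) : g (m + 2) = Δ * g (m + 1) - g m := by
    apply mul_left_cancel₀ hd0
    rw [← hg, hrec, hg (m + 1), hg m]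
    ring
  have hcop (x : ℝ) (_ : x ∈ Set.Icc α β) : (g 0).eval x ≠ 0 ∨ (g 1).eval x ≠ 0 := by
    by_contra! h
    have hbez := EuclideanDomain.gcd_eq_gcd_ab (f 0) (f 1)
    rw [← hd, hg 0, hg 1, mul_assoc, mul_assoc, ← mul_add] at hbez
    have := congrArg (eval x) (mul_left_cancel₀ hd0 ((mul_one d).trans hbez))
    simp [h.1, h.2] at this
  have hfin (q : ℝ[X]) (hq : q ≠ 0) : {x ∈ Set.Icc α β | q.eval x = 0}.Finite :=
    (finite_setOfPred_isRoot hq).subset fun x hx => hx.2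
  have hcount (m : ℕ) : {x ∈ Set.Icc α β | (f m).eval x = 0}.ncard =
      {x ∈ Set.Icc α β | d.eval x = 0}.ncard + {x ∈ Set.Icc α β | (g m).eval x = 0}.ncard := by
    rw [← Set.ncard_union_eq ?_ (hfin d hd0) (hfin (g m) (hg0 m))]
    · congr 1
      ext x
      simp only [Set.mem_union, Set.mem_ofPred_eq, hg m, eval_mul, mul_eq_zero, and_or_left]
    · rw [Set.disjoint_left]
      intro x hx hx'
      exact hsimple m x (by simp [hg m, hx.2]) (by simp [hg m, hx.2, hx'.2])
  obtain ⟨M, hM⟩ : ∃ M, ∀ m ≥ M, {x ∈ Set.Icc α β | (g (m + 1)).eval x = 0}.ncard =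
      {x ∈ Set.Icc α β | (g m).eval x = 0}.ncard + 1 := by
    rcases hedge with ⟨h, hα, hβ⟩ | ⟨h, hα, hβ⟩
    · exact eventually_ncard_zeros_succ_of_derivative_neg hαβ hgrec hcop hΔ h hα hβ
    · exact eventually_ncard_zeros_succ_of_derivative_pos hαβ hgrec hcop hΔ h hα hβ
  refine ⟨M, fun m hm => ?_⟩
  rw [hcount, hcount, hM m hm, add_assoc]

theorem det_JacobiT {a : ℕ → ℝ} (ha : ∀ n, a n ≠ 0) (b : ℕ → ℝ) (n : ℕ) (x : ℝ) :
    (JacobiT a b n x).det = a 0 / a n := by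
  induction n with
  | zero => simp [JacobiT, ha 0]
  | succ n ih =>
    have := ha n
    have := ha (n + 1)
    rw [JacobiT, det_mul, ih, JacobiA, det_smul, det_fin_two_of]
    simp only [Fintype.card_fin]
    field_simp
    ring

theorem JacobiT_add_two_periods {a b : ℕ → ℝ} {p : ℕ} (ha : ∀ n, a n ≠ 0)
    (hpera : ∀ n, 1 ≤ n → a (n + p) = a n)
    (hperb : ∀ n, 1 ≤ n → b (n + p) = b n) (ha0 : a 0 = a p) (n : ℕ) (x : ℝ) :
    JacobiT a b (n + p + p) x =
      JacobiDisc a b p x • JacobiT a b (n + p) x - JacobiT a b n x := by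
  have hdet : (JacobiT a b p x).det = 1 := by rw [det_JacobiT ha, ha0, div_self (ha p)]
  have hCH : JacobiT a b p x * JacobiT a b p x =
      JacobiDisc a b p x • JacobiT a b p x - 1 := by
    rw [JacobiDisc]
    generalize JacobiT a b p x = T at hdet
    rw [det_fin_two] at hdet
    ext i j
    fin_cases i <;> fin_cases j <;>
      simp [mul_apply, Fin.sum_univ_two, trace_fin_two] <;>
      first | linear_combination -hdet | ring
  rw [JacobiT_add_period hpera hperb ha0, JacobiT_add_period hpera hperb ha0, mul_assoc, hCH,
    mul_sub, mul_smul_comm, mul_one]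

theorem JacobiT_succ_apply_zero {a : ℕ → ℝ} (b : ℕ → ℝ) (n : ℕ) (x : ℝ) (j : Fin 2) :
    JacobiT a b (n + 1) x 0 j = (a (n + 1))⁻¹ *
      ((x - b (n + 1)) * JacobiT a b n x 0 j - a n * JacobiT a b n x 1 j) := by
  simp [JacobiT, JacobiA, mul_apply, Fin.sum_univ_two]
  ring

theorem JacobiT_succ_apply_one {a : ℕ → ℝ} (ha : ∀ n, a n ≠ 0) (b : ℕ → ℝ) (n : ℕ) (x : ℝ)
    (j : Fin 2) : JacobiT a b (n + 1) x 1 j = JacobiT a b n x 0 j := by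
  simp [JacobiT, JacobiA, mul_apply, Fin.sum_univ_two, ha (n + 1)]

theorem exists_natDegree_le_JacobiT {a : ℕ → ℝ} (ha : ∀ n, a n ≠ 0) (b : ℕ → ℝ) (n : ℕ) :
    ∃ R S : ℝ[X], R.natDegree ≤ n ∧ S.natDegree ≤ n ∧
      ∀ x, JacobiT a b n x 0 1 = R.eval x ∧ JacobiT a b n x 1 1 = S.eval x := by
  induction n with
  | zero => exact ⟨0, 1, by simp, by simp, by simp [JacobiT]⟩
  | succ n ih =>
    obtain ⟨R, S, hR, hS, h⟩ := ih
    refine ⟨C (a (n + 1))⁻¹ * ((X - C (b (n + 1))) * R - C (a n) * S), R, ?_, by omega,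
      fun x => ⟨?_, ?_⟩⟩
    · refine (natDegree_C_mul_le _ _).trans ((natDegree_sub_le _ _).trans (max_le ?_ ?_))
      · refine natDegree_mul_le.trans ?_
        rw [natDegree_X_sub_C]
        omega
      · exact (natDegree_C_mul_le _ _).trans (by omega)
    · simp [JacobiT_succ_apply_zero, h]
    · rw [JacobiT_succ_apply_one ha, (h x).1]

theorem eval_eq_JacobiT {a b : ℕ → ℝ} (ha : ∀ n, a n ≠ 0) {P : ℕ → ℝ[X]}
    (hP0 : P 0 = 1) (hP1 : X * P 0 = a 1 • P 1 + b 1 • P 0)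
    (hP : ∀ n, 1 ≤ n → X * P n = a (n + 1) • P (n + 1) + b (n + 1) • P n + a n • P (n - 1))
    (n : ℕ) (x : ℝ) : (P n).eval x = JacobiT a b n x 0 0 := by
  induction n using Nat.twoStepInduction with
  | zero => simp [hP0, JacobiT]
  | one =>
    have h := congrArg (eval x) hP1
    simp only [hP0, mul_one, eval_X, eval_add, eval_smul, eval_one, smul_eq_mul] at h
    rw [JacobiT_succ_apply_zero, eq_inv_mul_iff_mul_eq₀ (ha _)]
    simp [JacobiT]
    linarith
  | more n h₁ h₂ =>
    have h := congrArg (eval x) (hP (n + 1) (Nat.succ_pos n))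
    simp only [eval_mul, eval_X, eval_add, eval_smul, smul_eq_mul, Nat.add_sub_cancel] at h
    rw [JacobiT_succ_apply_zero, eq_inv_mul_iff_mul_eq₀ (ha _), JacobiT_succ_apply_one ha,
      ← h₁, ← h₂]
    linarith

theorem natDegree_of_recurrence {a b : ℕ → ℝ} (ha : ∀ n, a n ≠ 0) {P : ℕ → ℝ[X]}
    (hP0 : P 0 = 1) (hP1 : X * P 0 = a 1 • P 1 + b 1 • P 0)
    (hP : ∀ n, 1 ≤ n → X * P n = a (n + 1) • P (n + 1) + b (n + 1) • P n + a n • P (n - 1))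
    (n : ℕ) : (P n).natDegree = n := by
  have hsmul (n : ℕ) (q : ℝ[X]) : (a n • q).natDegree = q.natDegree :=
    natDegree_smul q (ha n)
  induction n using Nat.twoStepInduction with
  | zero => simp [hP0]
  | one =>
    have h : a 1 • P 1 = X - C (b 1) := by
      rw [eq_sub_iff_add_eq, ← mul_one (C (b 1)), ← smul_eq_C_mul, ← hP0, ← hP1, hP0, mul_one]
    rw [← hsmul 1, h, natDegree_X_sub_C]
  | more n h₁ h₂ =>
    have h : a (n + 2) • P (n + 2) =
        (X - C (b (n + 2))) * P (n + 1) - a (n + 1) • P n := by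
      have := hP (n + 1) (Nat.succ_pos n)
      rw [sub_mul, this, ← smul_eq_C_mul]
      simp only [Nat.add_sub_cancel]
      abel
    have hne : P (n + 1) ≠ 0 := ne_zero_of_natDegree_gt (n := n) (by omega)
    have hdeg : ((X - C (b (n + 2))) * P (n + 1)).natDegree = n + 2 := by
      rw [natDegree_mul (X_sub_C_ne_zero _) hne, natDegree_X_sub_C, h₂]
      omega
    rw [← hsmul (n + 2), h, natDegree_sub_eq_left_of_natDegree_lt, hdeg]
    rw [hsmul, hdeg]
    omega

theorem derivative_ne_zero_of_recurrence {a b : ℕ → ℝ} (ha : ∀ n, 0 < a n) {P : ℕ → ℝ[X]}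
    (hP0 : P 0 = 1) (hP1 : X * P 0 = a 1 • P 1 + b 1 • P 0)
    (hP : ∀ n, 1 ≤ n → X * P n = a (n + 1) • P (n + 1) + b (n + 1) • P n + a n • P (n - 1))
    (n : ℕ) {x : ℝ} (hx : (P n).eval x = 0) : (P n).derivative.eval x ≠ 0 := by
  have hW (n : ℕ) : 0 < (P (n + 1)).derivative.eval x * (P n).eval x -
      (P (n + 1)).eval x * (P n).derivative.eval x := by
    induction n with
    | zero =>
      have h := congrArg (fun q => q.derivative.eval x) hP1
      simp [hP0] at h
      simp only [hP0, derivative_one, eval_one, eval_zero, mul_zero, sub_zero, mul_one, zero_add]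
      exact pos_of_mul_pos_right (h ▸ one_pos) (ha 1).le
    | succ n ih =>
      have h := hP (n + 1) (Nat.succ_pos n)
      have h₁ := congrArg (eval x) h
      have h₂ := congrArg (fun q => q.derivative.eval x) h
      simp only [eval_mul, eval_X, eval_add, eval_smul, smul_eq_mul, Nat.add_sub_cancel,
        derivative_mul, derivative_X, derivative_add, derivative_smul, eval_one] at h₁ h₂
      refine pos_of_mul_pos_right (a := a (n + 1 + 1)) ?_ (ha _).le
      have hpos := mul_pos (ha (n + 1)) ih
      have hsq := sq_nonneg ((P (n + 1)).eval x)
      have key : a (n + 1 + 1) * ((P (n + 1 + 1)).derivative.eval x * (P (n + 1)).eval x -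
          (P (n + 1 + 1)).eval x * (P (n + 1)).derivative.eval x) = (P (n + 1)).eval x ^ 2 +
          a (n + 1) * ((P (n + 1)).derivative.eval x * (P n).eval x -
            (P (n + 1)).eval x * (P n).derivative.eval x) := by
        linear_combination (P (n + 1)).derivative.eval x * h₁ - (P (n + 1)).eval x * h₂
      rw [key]
      positivity
  cases n with
  | zero => simp [hP0] at hx
  | succ n =>
    intro h
    have := hW n
    simp [hx, h] at this

theorem exists_polynomial_eval_eq_JacobiDisc {a b : ℕ → ℝ} (ha : ∀ n, a n ≠ 0) {P : ℕ → ℝ[X]}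
    (hP0 : P 0 = 1) (hP1 : X * P 0 = a 1 • P 1 + b 1 • P 0)
    (hP : ∀ n, 1 ≤ n → X * P n = a (n + 1) • P (n + 1) + b (n + 1) • P n + a n • P (n - 1))
    {p : ℕ} (hp : 1 ≤ p) :
    ∃ Q : ℝ[X], Q.natDegree = p ∧ ∀ x, JacobiDisc a b p x = Q.eval x := by
  obtain ⟨q, rfl⟩ := Nat.exists_eq_add_of_le' hp
  obtain ⟨R, _, hR, _, h⟩ := exists_natDegree_le_JacobiT ha b q
  have hdeg := natDegree_of_recurrence ha hP0 hP1 hP (q + 1)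
  refine ⟨P (q + 1) + R, ?_, fun x => ?_⟩
  · rw [natDegree_add_eq_left_of_natDegree_lt (by omega), hdeg]
  · rw [JacobiDisc, trace_fin_two, eval_add, eval_eq_JacobiT ha hP0 hP1 hP,
      JacobiT_succ_apply_one ha, (h x).1]

/-- **Theorem 2.5 (counting part, including (2.49)).** Assume all gaps are open.
For each `1 ≤ r ≤ p` and each band `B`, there are integers `D` and `M` such that for
`m ≥ M` the number of zeros of `p_{mp+r-1}` in `B` is `m - D` or `m - D + 1`; in
particular `sup_n |n/p - N⁽ⁿ⁾(B)| < ∞`. -/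
theorem oprl_periodic_clock_zero_count
    (p : ℕ) (hp : 1 ≤ p) (a b : ℕ → ℝ)
    (ha : ∀ n, 1 ≤ n → 0 < a n)
    (hpera : ∀ n, 1 ≤ n → a (n + p) = a n)
    (hperb : ∀ n, 1 ≤ n → b (n + p) = b n)
    (ha0 : a 0 = a p)
    (P : ℕ → Polynomial ℝ)
    (hP0 : P 0 = 1)
    (hPrec0 : (X : Polynomial ℝ) * P 0 = a 1 • P 1 + b 1 • P 0)
    (hPrec : ∀ n, 1 ≤ n →
      (X : Polynomial ℝ) * P n = a (n + 1) • P (n + 1) + b (n + 1) • P n + a n • P (n - 1))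
    (hgaps : {C : Set ℝ | IsBand a b p C}.ncard = p)
    (B : Set ℝ) (hB : IsBand a b p B)
    (N : ℕ → ℕ)
    (hN : ∀ n, N n = {x ∈ B | (P n).eval x = 0}.ncard) :
    (∀ r : ℕ, 1 ≤ r → r ≤ p →
      ∃ D : ℤ, ∃ M : ℕ, ∀ m : ℕ, M ≤ m →
        (N (m * p + r - 1) : ℤ) = (m : ℤ) - D ∨ (N (m * p + r - 1) : ℤ) = (m : ℤ) - D + 1) ∧
      (∃ C : ℝ, ∀ n : ℕ, 1 ≤ n → |(n : ℝ) / (p : ℝ) - (N n : ℝ)| ≤ C) := by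
  have hapos : ∀ n, 0 < a n := by
    intro n
    rcases n.eq_zero_or_pos with rfl | hn
    · exact ha0 ▸ ha p hp
    · exact ha n hn
  have hane : ∀ n, a n ≠ 0 := fun n => (hapos n).ne'
  obtain ⟨Q, hQdeg, hQ⟩ := exists_polynomial_eval_eq_JacobiDisc hane hP0 hPrec0 hPrec hp
  have hS : bandSet a b p = {x | Q.eval x ∈ Set.Icc (-2 : ℝ) 2} := by
    simp only [bandSet, hQ]
  obtain ⟨x₀, hx₀, hBx⟩ := hB
  obtain ⟨α, β, hαβ, hIcc, hedge⟩ := connectedComponentIn_eq_Icc_of_derivative_ne_zero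
    (natDegree_pos_iff_degree_pos.1 (by omega)) hS
    (fun x hx => derivative_ne_zero_of_ncard_components hp hQdeg hS hgaps hx) hx₀
  have hsub : Set.Icc α β ⊆ bandSet a b p := hIcc ▸ connectedComponentIn_subset _ _
  have hev (s : ℕ) : ∃ M, ∀ m ≥ M, N ((m + 1) * p + s) = N (m * p + s) + 1 := by
    simp only [hN, hBx, hIcc]
    refine eventually_ncard_zeros_succ (f := fun m => P (m * p + s)) hαβ (fun m => ?_)
      (fun m x hx => derivative_ne_zero_of_recurrence hapos hP0 hPrec0 hPrec _ hx)
      (fun x hx => by simpa [hS] using hsub hx) hedge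
    refine Polynomial.funext fun x => ?_
    rw [eval_sub, eval_mul, ← hQ]
    simp only [eval_eq_JacobiT hane hP0 hPrec0 hPrec]
    rw [show (m + 2) * p + s = m * p + s + p + p by ring,
      show (m + 1) * p + s = m * p + s + p by ring,
      JacobiT_add_two_periods hane hpera hperb ha0]
    simp
  have hcount (s : ℕ) : ∃ D : ℤ, ∃ M : ℕ, ∀ m ≥ M, (N (m * p + s) : ℤ) = m - D := by
    obtain ⟨M, hM⟩ := hev s
    refine ⟨M - N (M * p + s), M, fun m hm => ?_⟩
    induction m, hm using Nat.le_induction with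
    | base => ring
    | succ m hm ih =>
      rw [hM m hm]
      push_cast
      rw [ih]
      ring
  refine ⟨fun r hr _ => ?_, ?_⟩
  · obtain ⟨D, M, h⟩ := hcount (r - 1)
    refine ⟨D, M, fun m hm => Or.inl ?_⟩
    rw [Nat.add_sub_assoc hr]
    exact h m hm
  · have hbdd (s : ℕ) : ∃ C : ℝ, ∀ m : ℕ, |(m : ℝ) - N (m * p + s)| ≤ C := by
      obtain ⟨D, M, h⟩ := hcount s
      refine ⟨|(D : ℝ)| + ∑ m ∈ Finset.range M, |(m : ℝ) - N (m * p + s)|, fun m => ?_⟩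
      rcases lt_or_ge m M with hm | hm
      · have := Finset.single_le_sum (f := fun m : ℕ => |(m : ℝ) - N (m * p + s)|)
          (fun _ _ => abs_nonneg _) (Finset.mem_range.2 hm)
        exact this.trans (le_add_of_nonneg_left (abs_nonneg _))
      · have hD : (N (m * p + s) : ℝ) = m - D := mod_cast h m hm
        rw [hD, sub_sub_cancel]
        exact le_add_of_nonneg_right (Finset.sum_nonneg fun _ _ => abs_nonneg _)
    choose C hC using hbdd
    have hCnonneg (s : ℕ) : 0 ≤ C s := (abs_nonneg _).trans (hC s 0)
    refine ⟨1 + ∑ s ∈ Finset.range p, C s, fun n _ => ?_⟩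
    have hmod := Nat.mod_lt n hp
    have hp0 : (0 : ℝ) < p := mod_cast hp
    have hdiv : (n : ℝ) / p = (n / p : ℕ) + (n % p : ℕ) / p := by
      rw [eq_comm, ← eq_sub_iff_add_eq', div_eq_iff hp0.ne', sub_mul, div_mul_cancel₀ _ hp0.ne',
        eq_sub_iff_add_eq]
      exact_mod_cast Nat.mod_add_div' n p
    have hfrac : |((n % p : ℕ) : ℝ) / p| ≤ 1 := by
      rw [abs_of_nonneg (by positivity), div_le_one hp0]
      exact_mod_cast hmod.le
    have hbound : |((n / p : ℕ) : ℝ) - N n| ≤ C (n % p) := by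
      simpa only [Nat.div_add_mod'] using hC (n % p) (n / p)
    have hsum := Finset.single_le_sum (f := C) (fun s _ => hCnonneg s) (Finset.mem_range.2 hmod)
    calc |(n : ℝ) / p - N n|
        = |((n % p : ℕ) : ℝ) / p + (((n / p : ℕ) : ℝ) - N n)| := by rw [hdiv]; ring_nf
      _ ≤ 1 + ∑ s ∈ Finset.range p, C s :=
        (abs_add_le _ _).trans (add_le_add hfrac (hbound.trans hsum))
end

section
/- A point z₀ ∈ ℂ is a limit of zeros of the polynomials p_n — that is, there exist z_n ∈ ℂ with p_n(z_n) = 0 and z_n → z₀ — if and only if z₀ belongs to the support of μ. (Proposition 2.6.) -/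
open Polynomial MeasureTheory Filter

/-- The (topological) support of a measure: the set of points all of whose
neighborhoods have positive measure. -/
def measSupport {X : Type*} [TopologicalSpace X] [MeasurableSpace X]
    (μ : Measure X) : Set X :=
  {x : X | ∀ U ∈ nhds x, 0 < μ U}

section OrthonormalPolynomials

variable {L : ℝ[X] →ₗ[ℝ] ℝ} {P : ℕ → ℝ[X]}

theorem exists_eq_sum_smul_of_degree_lt (hdeg : ∀ n, (P n).natDegree = n)
    (hlead : ∀ n, 0 < (P n).leadingCoeff) {f : ℝ[X]} {n : ℕ} (hf : f.degree < n) :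
    ∃ c : ℕ → ℝ, f = ∑ j ∈ Finset.range n, c j • P j := by
  let S : Polynomial.Sequence ℝ :=
    ⟨P, fun i => by
      rw [degree_eq_natDegree (leadingCoeff_ne_zero.mp (hlead i).ne'), hdeg]⟩
  have hS : Submodule.span ℝ (S '' Set.Iio n) = degreeLT ℝ n :=
    S.span_degreeLT fun i _ => (hlead i).ne'.isUnit
  have hmem : f ∈ Submodule.span ℝ (P '' (Finset.range n : Set ℕ)) := by
    have : f ∈ degreeLT ℝ n := mem_degreeLT.mpr hf
    rw [← hS] at this
    rwa [Finset.coe_range]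
  obtain ⟨c, hc⟩ := (Submodule.mem_span_image_finset_iff_exists_fun ℝ).mp hmem
  refine ⟨fun j => if h : j ∈ Finset.range n then c ⟨j, h⟩ else 0, ?_⟩
  rw [← hc, ← Finset.sum_attach (Finset.range n), Finset.univ_eq_attach]
  refine Finset.sum_congr rfl fun j _ => ?_
  simp only [dif_pos j.2]

theorem map_mul_sum_smul (horth : ∀ n m, L (P n * P m) = if n = m then 1 else 0)
    (c : ℕ → ℝ) (n k : ℕ) :
    L (P k * ∑ j ∈ Finset.range n, c j • P j) = if k < n then c k else 0 := by
  simp [Finset.mul_sum, horth]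

theorem map_sum_smul_sq (horth : ∀ n m, L (P n * P m) = if n = m then 1 else 0)
    (c : ℕ → ℝ) (n : ℕ) :
    L ((∑ j ∈ Finset.range n, c j • P j) ^ 2) = ∑ j ∈ Finset.range n, c j ^ 2 := by
  rw [sq]
  nth_rw 1 [Finset.sum_mul]
  simp only [map_sum, smul_mul_assoc, map_smul, map_mul_sum_smul horth, smul_eq_mul]
  refine Finset.sum_congr rfl fun j hj => ?_
  rw [if_pos (Finset.mem_range.mp hj), sq]

theorem map_mul_eq_zero_of_degree_lt (hdeg : ∀ n, (P n).natDegree = n)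
    (hlead : ∀ n, 0 < (P n).leadingCoeff)
    (horth : ∀ n m, L (P n * P m) = if n = m then 1 else 0)
    {f : ℝ[X]} {n : ℕ} (hf : f.degree < n) : L (P n * f) = 0 := by
  obtain ⟨c, rfl⟩ := exists_eq_sum_smul_of_degree_lt hdeg hlead hf
  simp [map_mul_sum_smul horth]

theorem map_sq_pos_of_ne_zero (hdeg : ∀ n, (P n).natDegree = n)
    (hlead : ∀ n, 0 < (P n).leadingCoeff)
    (horth : ∀ n m, L (P n * P m) = if n = m then 1 else 0)
    {f : ℝ[X]} (hf : f ≠ 0) : 0 < L (f ^ 2) := by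
  obtain ⟨c, hc⟩ := exists_eq_sum_smul_of_degree_lt hdeg hlead
    (f := f) (n := f.natDegree + 1)
    (by rw [degree_eq_natDegree hf]; exact_mod_cast Nat.lt_succ_self _)
  rw [hc, map_sum_smul_sq horth]
  refine (Finset.sum_nonneg fun _ _ => sq_nonneg _).lt_of_ne fun h => hf ?_
  rw [hc]
  refine Finset.sum_eq_zero fun j hj => ?_
  have := (Finset.sum_eq_zero_iff_of_nonneg fun _ _ => sq_nonneg _).mp h.symm j hj
  rw [pow_eq_zero_iff two_ne_zero] at this
  rw [this, zero_smul]

theorem map_sq_nonneg (hdeg : ∀ n, (P n).natDegree = n)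
    (hlead : ∀ n, 0 < (P n).leadingCoeff)
    (horth : ∀ n m, L (P n * P m) = if n = m then 1 else 0) (f : ℝ[X]) : 0 ≤ L (f ^ 2) := by
  rcases eq_or_ne f 0 with rfl | hf
  · simp
  · exact (map_sq_pos_of_ne_zero hdeg hlead horth hf).le

/-- The extremal property of the Christoffel–Darboux kernel on the diagonal. -/
theorem eval_sq_le_sum_eval_sq_mul (hdeg : ∀ n, (P n).natDegree = n)
    (hlead : ∀ n, 0 < (P n).leadingCoeff)
    (horth : ∀ n m, L (P n * P m) = if n = m then 1 else 0)
    {f : ℝ[X]} {n : ℕ} (hf : f.degree < n) (x : ℝ) :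
    f.eval x ^ 2 ≤ (∑ j ∈ Finset.range n, (P j).eval x ^ 2) * L (f ^ 2) := by
  obtain ⟨c, rfl⟩ := exists_eq_sum_smul_of_degree_lt hdeg hlead hf
  rw [map_sum_smul_sq horth, mul_comm]
  simp only [eval_finsetSum, eval_smul, smul_eq_mul]
  exact Finset.sum_mul_sq_le_sq_mul_sq _ _ _

theorem im_eq_zero_of_aeval_eq_zero (hdeg : ∀ n, (P n).natDegree = n)
    (hlead : ∀ n, 0 < (P n).leadingCoeff)
    (horth : ∀ n m, L (P n * P m) = if n = m then 1 else 0)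
    {n : ℕ} {z : ℂ} (hz : aeval z (P n) = 0) : z.im = 0 := by
  by_contra him
  have hne : P n ≠ 0 := leadingCoeff_ne_zero.mp (hlead n).ne'
  obtain ⟨r, hr⟩ := quadratic_dvd_of_aeval_eq_zero_im_ne_zero (P n) hz him
  have hr0 : r ≠ 0 := by rintro rfl; exact hne (by rw [hr, mul_zero])
  set Q : ℝ[X] := X ^ 2 - C (2 * z.re) * X + C (‖z‖ ^ 2) with hQ
  have hQ' : Q = (X - C z.re) ^ 2 + C (z.im ^ 2) := by
    rw [hQ, Complex.sq_norm, Complex.normSq_apply]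
    simp only [map_add, map_mul, map_pow, map_ofNat]
    ring
  have hQd : Q.natDegree = 2 := by
    rw [hQ]; compute_degree!
  have hQ0 : Q ≠ 0 := by rintro h; simp [h] at hQd
  have hd : r.natDegree < n := by
    have := hdeg n
    rw [hr, natDegree_mul hQ0 hr0, hQd] at this
    omega
  have hzero := map_mul_eq_zero_of_degree_lt hdeg hlead horth
    (f := r) (n := n) ((natDegree_lt_iff_degree_lt hr0).mp hd)
  have hexp : P n * r = ((X - C z.re) * r) ^ 2 + (z.im ^ 2) • r ^ 2 := by
    rw [hr, hQ', smul_eq_C_mul]; ring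
  rw [hexp, map_add, map_smul, smul_eq_mul] at hzero
  have h1 := map_sq_nonneg hdeg hlead horth ((X - C z.re) * r)
  have h2 := mul_pos (sq_pos_of_ne_zero him) (map_sq_pos_of_ne_zero hdeg hlead horth hr0)
  linarith

theorem not_sq_dvd (hdeg : ∀ n, (P n).natDegree = n)
    (hlead : ∀ n, 0 < (P n).leadingCoeff)
    (horth : ∀ n m, L (P n * P m) = if n = m then 1 else 0)
    (n : ℕ) (z : ℝ) : ¬ (X - C z) ^ 2 ∣ P n := by
  rintro ⟨r, hr⟩
  have hne : P n ≠ 0 := leadingCoeff_ne_zero.mp (hlead n).ne'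
  have hr0 : r ≠ 0 := by rintro rfl; exact hne (by rw [hr, mul_zero])
  have hd : r.natDegree < n := by
    have := hdeg n
    rw [hr, natDegree_mul (pow_ne_zero _ (X_sub_C_ne_zero z)) hr0, natDegree_pow,
      natDegree_X_sub_C] at this
    omega
  have hzero := map_mul_eq_zero_of_degree_lt hdeg hlead horth
    (f := r) (n := n) ((natDegree_lt_iff_degree_lt hr0).mp hd)
  have hexp : P n * r = ((X - C z) * r) ^ 2 := by rw [hr]; ring
  rw [hexp] at hzero
  exact (map_sq_pos_of_ne_zero hdeg hlead horth
    (mul_ne_zero (X_sub_C_ne_zero z) hr0)).ne' hzero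

theorem splits_of_orthonormal (hdeg : ∀ n, (P n).natDegree = n)
    (hlead : ∀ n, 0 < (P n).leadingCoeff)
    (horth : ∀ n m, L (P n * P m) = if n = m then 1 else 0) (n : ℕ) : (P n).Splits := by
  have hne : P n ≠ 0 := leadingCoeff_ne_zero.mp (hlead n).ne'
  refine Splits.of_splits_map (algebraMap ℝ ℂ) (IsAlgClosed.splits _) fun z hz => ?_
  have hz' : aeval z (P n) = 0 := by
    rw [mem_roots_map hne] at hz
    exact hz
  exact ⟨z.re, Complex.ext rfl (im_eq_zero_of_aeval_eq_zero hdeg hlead horth hz').symm⟩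

theorem nodup_roots_of_orthonormal (hdeg : ∀ n, (P n).natDegree = n)
    (hlead : ∀ n, 0 < (P n).leadingCoeff)
    (horth : ∀ n m, L (P n * P m) = if n = m then 1 else 0) (n : ℕ) : (P n).roots.Nodup := by
  have hne : P n ≠ 0 := leadingCoeff_ne_zero.mp (hlead n).ne'
  refine Multiset.nodup_iff_count_le_one.mpr fun z => ?_
  rw [count_roots]
  by_contra! h
  exact not_sq_dvd hdeg hlead horth n z ((le_rootMultiplicity_iff hne).mp h)

/-- Gaussian quadrature for squares. -/
theorem map_sq_eq_sum_roots (hdeg : ∀ n, (P n).natDegree = n)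
    (hlead : ∀ n, 0 < (P n).leadingCoeff)
    (horth : ∀ n m, L (P n * P m) = if n = m then 1 else 0)
    {f : ℝ[X]} {n : ℕ} (hf : f.degree < n) :
    L (f ^ 2) = ∑ z ∈ (P n).roots.toFinset,
      f.eval z ^ 2 * L (Lagrange.basis (P n).roots.toFinset id z ^ 2) := by
  set s := (P n).roots.toFinset with hs
  have hne : P n ≠ 0 := leadingCoeff_ne_zero.mp (hlead n).ne'
  have hsplit := splits_of_orthonormal hdeg hlead horth n
  have hnodup := nodup_roots_of_orthonormal hdeg hlead horth n
  have hcard : s.card = n := by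
    rw [hs, Multiset.toFinset_card_of_nodup hnodup, ← hsplit.natDegree_eq_card_roots, hdeg]
  have hinj : Set.InjOn (id : ℝ → ℝ) s := Set.injOn_id _
  have hoff : ∀ i ∈ s, ∀ j ∈ s, i ≠ j →
      L (Lagrange.basis s id i * Lagrange.basis s id j) = 0 := by
    intro i hi j hj hij
    have hdvd : P n ∣ Lagrange.basis s id i * Lagrange.basis s id j := by
      refine hsplit.dvd_of_roots_le_roots hne ((Multiset.le_iff_subset hnodup).mpr fun z hz => ?_)
      have hzs : z ∈ s := Multiset.mem_toFinset.mpr hz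
      rw [mem_roots (mul_ne_zero (Lagrange.basis_ne_zero hinj hi)
        (Lagrange.basis_ne_zero hinj hj)), IsRoot, eval_mul]
      rcases eq_or_ne i z with rfl | hiz
      · exact mul_eq_zero_of_right _ (Lagrange.eval_basis_of_ne (v := id) hij.symm hzs)
      · exact mul_eq_zero_of_left (Lagrange.eval_basis_of_ne (v := id) hiz hzs) _
    obtain ⟨q, hq⟩ := hdvd
    rw [hq]
    rcases eq_or_ne q 0 with rfl | hq0
    · simp
    refine map_mul_eq_zero_of_degree_lt hdeg hlead horth
      ((natDegree_lt_iff_degree_lt hq0).mp ?_)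
    have hb : ∀ k ∈ s, (Lagrange.basis s id k).natDegree = n - 1 := fun k hk => by
      rw [natDegree_eq_of_degree_eq_some (Lagrange.degree_basis hinj hk), hcard]
    have h0 : 0 < n := by rw [← hcard]; exact Finset.card_pos.mpr ⟨i, hi⟩
    have := congrArg natDegree hq
    rw [natDegree_mul (Lagrange.basis_ne_zero hinj hi) (Lagrange.basis_ne_zero hinj hj),
      natDegree_mul hne hq0, hb i hi, hb j hj, hdeg] at this
    omega
  have hfs : f = ∑ z ∈ s, f.eval z • Lagrange.basis s id z := by
    have := Lagrange.eq_interpolate (f := f) hinj (by rwa [hcard])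
    rw [Lagrange.interpolate_apply] at this
    simpa only [smul_eq_C_mul, id] using this
  conv_lhs => rw [hfs]
  rw [sq, Finset.sum_mul_sum, map_sum]
  refine Finset.sum_congr rfl fun i hi => ?_
  rw [map_sum, Finset.sum_eq_single_of_mem i hi]
  · rw [smul_mul_smul_comm, map_smul, smul_eq_mul, sq, sq]
  · intro j hj hji
    rw [smul_mul_smul_comm, map_smul, hoff i hi j hj hji.symm, smul_zero]

theorem sq_mul_map_sq_le_of_le_abs_roots (hdeg : ∀ n, (P n).natDegree = n)
    (hlead : ∀ n, 0 < (P n).leadingCoeff)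
    (horth : ∀ n m, L (P n * P m) = if n = m then 1 else 0)
    {f : ℝ[X]} {n : ℕ} (hf : f.natDegree + 1 < n) {x ε : ℝ} (hε : 0 ≤ ε)
    (hroots : ∀ z, (P n).eval z = 0 → ε ≤ |z - x|) :
    ε ^ 2 * L (f ^ 2) ≤ L (((X - C x) * f) ^ 2) := by
  rcases eq_or_ne f 0 with rfl | hf0
  · simp
  have hne : P n ≠ 0 := leadingCoeff_ne_zero.mp (hlead n).ne'
  have h1 : f.degree < n := (natDegree_lt_iff_degree_lt hf0).mp (by omega)
  have h2 : ((X - C x) * f).degree < (n : WithBot ℕ) := by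
    refine (natDegree_lt_iff_degree_lt (mul_ne_zero (X_sub_C_ne_zero x) hf0)).mp ?_
    rw [natDegree_mul (X_sub_C_ne_zero x) hf0, natDegree_X_sub_C]
    omega
  rw [map_sq_eq_sum_roots hdeg hlead horth h1, map_sq_eq_sum_roots hdeg hlead horth h2,
    Finset.mul_sum]
  refine Finset.sum_le_sum fun z hz => ?_
  rw [← mul_assoc]
  refine mul_le_mul_of_nonneg_right ?_ (map_sq_nonneg hdeg hlead horth _)
  have hz' : (P n).eval z = 0 := by
    rw [Multiset.mem_toFinset, mem_roots hne] at hz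
    exact hz
  have := pow_le_pow_left₀ hε (hroots z hz') 2
  rw [sq_abs] at this
  simp only [eval_mul, eval_sub, eval_X, eval_C, mul_pow]
  exact mul_le_mul_of_nonneg_right this (sq_nonneg _)

/-- The Christoffel–Darboux formula. -/
theorem X_sub_C_mul_christoffelDarboux {a b : ℕ → ℝ}
    (hPrec0 : (X : ℝ[X]) * P 0 = a 1 • P 1 + b 1 • P 0)
    (hPrec : ∀ n, 1 ≤ n →
      (X : ℝ[X]) * P n = a (n + 1) • P (n + 1) + b (n + 1) • P n + a n • P (n - 1))
    (x : ℝ) (n : ℕ) :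
    (X - C x) * ∑ j ∈ Finset.range (n + 1), (P j).eval x • P j =
      a (n + 1) • ((P n).eval x • P (n + 1) - (P (n + 1)).eval x • P n) := by
  induction n with
  | zero =>
    have h := congrArg (eval x) hPrec0
    simp only [eval_mul, eval_X, eval_add, eval_smul, smul_eq_mul] at h
    have h' := congrArg C h
    simp only [smul_eq_C_mul, map_mul, map_add] at hPrec0 h' ⊢
    simp only [zero_add, Finset.sum_range_one]
    linear_combination C (eval x (P 0)) * hPrec0 - P 0 * h'
  | succ n ih =>
    have hr := hPrec (n + 1) (by omega)
    have h := congrArg (eval x) hr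
    simp only [eval_mul, eval_X, eval_add, eval_smul, smul_eq_mul, Nat.add_sub_cancel] at h
    have h' := congrArg C h
    rw [Finset.sum_range_succ, mul_add, ih]
    simp only [smul_eq_C_mul, map_mul, map_add, Nat.add_sub_cancel] at hr h' ⊢
    linear_combination C (eval x (P (n + 1))) * hr - P (n + 1) * h'

theorem map_sq_X_sub_C_mul_christoffelDarboux
    (horth : ∀ n m, L (P n * P m) = if n = m then 1 else 0) {a b : ℕ → ℝ}
    (hPrec0 : (X : ℝ[X]) * P 0 = a 1 • P 1 + b 1 • P 0)
    (hPrec : ∀ n, 1 ≤ n →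
      (X : ℝ[X]) * P n = a (n + 1) • P (n + 1) + b (n + 1) • P n + a n • P (n - 1))
    (x : ℝ) (n : ℕ) :
    L (((X - C x) * ∑ j ∈ Finset.range (n + 1), (P j).eval x • P j) ^ 2) =
      a (n + 1) ^ 2 * ((P n).eval x ^ 2 + (P (n + 1)).eval x ^ 2) := by
  rw [X_sub_C_mul_christoffelDarboux hPrec0 hPrec]
  have : (a (n + 1) • ((P n).eval x • P (n + 1) - (P (n + 1)).eval x • P n)) ^ 2 =
      (a (n + 1) ^ 2) • (((P n).eval x ^ 2) • (P (n + 1) * P (n + 1))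
        - (2 * (P n).eval x * (P (n + 1)).eval x) • (P (n + 1) * P n)
        + ((P (n + 1)).eval x ^ 2) • (P n * P n)) := by
    simp only [smul_eq_C_mul, map_mul, map_pow, map_ofNat]
    ring
  rw [this]
  simp [horth]
  ring

/-- If a zero `z` of `P n` is close to a point `x` at positive distance from the support,
then `P n` is small at `x` compared with the Christoffel–Darboux kernel. -/
theorem sq_mul_eval_sq_le_of_root (hdeg : ∀ n, (P n).natDegree = n)
    (hlead : ∀ n, 0 < (P n).leadingCoeff)
    (horth : ∀ n m, L (P n * P m) = if n = m then 1 else 0)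
    {n : ℕ} {x z ε δ : ℝ} (hroot : (P n).eval z = 0) (hz : |z - x| ≤ ε)
    (hgap : ∀ f : ℝ[X], δ ^ 2 * L (f ^ 2) ≤ L (((X - C z) * f) ^ 2)) :
    δ ^ 2 * (P n).eval x ^ 2 ≤ ε ^ 2 * ∑ j ∈ Finset.range n, (P j).eval x ^ 2 := by
  have hne : P n ≠ 0 := leadingCoeff_ne_zero.mp (hlead n).ne'
  obtain ⟨q, hq⟩ := dvd_iff_isRoot.mpr hroot
  have hq0 : q ≠ 0 := by rintro rfl; exact hne (by rw [hq, mul_zero])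
  have hd : q.natDegree < n := by
    have := hdeg n
    rw [hq, natDegree_mul (X_sub_C_ne_zero z) hq0, natDegree_X_sub_C] at this
    omega
  have h1 := eval_sq_le_sum_eval_sq_mul hdeg hlead horth
    ((natDegree_lt_iff_degree_lt hq0).mp hd) x
  have h2 := hgap q
  rw [← hq, sq (P n), horth, if_pos rfl] at h2
  have h3 : (P n).eval x ^ 2 = (z - x) ^ 2 * q.eval x ^ 2 := by
    conv_lhs => rw [hq]
    simp only [eval_mul, eval_sub, eval_X, eval_C]
    ring
  have h4 : (z - x) ^ 2 ≤ ε ^ 2 := sq_le_sq' (abs_le.mp hz).1 (abs_le.mp hz).2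
  set K := ∑ j ∈ Finset.range n, (P j).eval x ^ 2
  have hK : 0 ≤ K := Finset.sum_nonneg fun _ _ => sq_nonneg _
  calc δ ^ 2 * (P n).eval x ^ 2 = (z - x) ^ 2 * (δ ^ 2 * q.eval x ^ 2) := by rw [h3]; ring
    _ ≤ ε ^ 2 * (δ ^ 2 * (K * L (q ^ 2))) := by gcongr
    _ = ε ^ 2 * K * (δ ^ 2 * L (q ^ 2)) := by ring
    _ ≤ ε ^ 2 * K * 1 := by gcongr
    _ = ε ^ 2 * K := mul_one _

/-- Two consecutive orthonormal polynomials cannot both have a zero very close to a point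
at distance `d` from the support. -/
theorem sq_mul_sq_le_of_consecutive_roots (hdeg : ∀ n, (P n).natDegree = n)
    (hlead : ∀ n, 0 < (P n).leadingCoeff)
    (horth : ∀ n m, L (P n * P m) = if n = m then 1 else 0) {a b : ℕ → ℝ}
    (hPrec0 : (X : ℝ[X]) * P 0 = a 1 • P 1 + b 1 • P 0)
    (hPrec : ∀ n, 1 ≤ n →
      (X : ℝ[X]) * P n = a (n + 1) • P (n + 1) + b (n + 1) • P n + a n • P (n - 1))
    {x d ε : ℝ}
    (hgap : ∀ (z : ℝ) (f : ℝ[X]), |z - x| ≤ ε →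
      (d - ε) ^ 2 * L (f ^ 2) ≤ L (((X - C z) * f) ^ 2))
    (hgap' : ∀ f : ℝ[X], d ^ 2 * L (f ^ 2) ≤ L (((X - C x) * f) ^ 2))
    {n : ℕ} {z w : ℝ} (hz : (P n).eval z = 0) (hzx : |z - x| ≤ ε)
    (hw : (P (n + 1)).eval w = 0) (hwx : |w - x| ≤ ε) :
    d ^ 2 * (d - ε) ^ 2 ≤ 2 * a (n + 1) ^ 2 * ε ^ 2 := by
  have h1 := sq_mul_eval_sq_le_of_root hdeg hlead horth hz hzx fun f => hgap z f hzx
  have h2 := sq_mul_eval_sq_le_of_root hdeg hlead horth hw hwx fun f => hgap w f hwx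
  have h3 := hgap' (∑ j ∈ Finset.range (n + 1), (P j).eval x • P j)
  rw [map_sq_X_sub_C_mul_christoffelDarboux horth hPrec0 hPrec, map_sum_smul_sq horth] at h3
  have h4 : ∑ j ∈ Finset.range n, (P j).eval x ^ 2 ≤
      ∑ j ∈ Finset.range (n + 1), (P j).eval x ^ 2 := by
    rw [Finset.sum_range_succ]
    exact le_add_of_nonneg_right (sq_nonneg _)
  have hK : 0 < ∑ j ∈ Finset.range (n + 1), (P j).eval x ^ 2 := by
    rw [Finset.sum_range_succ']
    refine add_pos_of_nonneg_of_pos (Finset.sum_nonneg fun _ _ => sq_nonneg _) ?_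
    have h0 := hlead 0
    rw [eq_C_of_natDegree_eq_zero (hdeg 0), leadingCoeff_C] at h0
    rw [eq_C_of_natDegree_eq_zero (hdeg 0), eval_C]
    positivity
  set K := ∑ j ∈ Finset.range (n + 1), (P j).eval x ^ 2
  set A := (P n).eval x ^ 2
  set B := (P (n + 1)).eval x ^ 2
  refine le_of_mul_le_mul_right ?_ hK
  calc d ^ 2 * (d - ε) ^ 2 * K = (d - ε) ^ 2 * (d ^ 2 * K) := by ring
    _ ≤ (d - ε) ^ 2 * (a (n + 1) ^ 2 * (A + B)) := by gcongr
    _ = a (n + 1) ^ 2 * ((d - ε) ^ 2 * A + (d - ε) ^ 2 * B) := by ring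
    _ ≤ a (n + 1) ^ 2 * (ε ^ 2 * K + ε ^ 2 * K) := by
      refine mul_le_mul_of_nonneg_left (add_le_add (h1.trans ?_) h2) (sq_nonneg _)
      exact mul_le_mul_of_nonneg_left h4 (sq_nonneg _)
    _ = 2 * a (n + 1) ^ 2 * ε ^ 2 * K := by ring

end OrthonormalPolynomials

section Support

variable {μ : Measure ℝ}

theorem measSupport_eq_support : measSupport μ = μ.support :=
  Set.ext fun x => (Measure.mem_support_iff_forall x).symm

theorem ae_mem_measSupport : ∀ᵐ y ∂μ, y ∈ measSupport μ := by
  rw [measSupport_eq_support]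
  exact Measure.support_mem_ae

theorem exists_pos_forall_le_abs_sub_of_notMem {x : ℝ} (hx : x ∉ measSupport μ) :
    ∃ d > 0, ∀ y ∈ measSupport μ, d ≤ |y - x| := by
  rw [measSupport_eq_support] at hx ⊢
  obtain ⟨d, hd, hball⟩ :=
    Metric.isOpen_iff.mp (Measure.isOpen_compl_support (μ := μ)) x hx
  refine ⟨d, hd, fun y hy => ?_⟩
  by_contra! h
  exact hball (by rwa [Metric.mem_ball, Real.dist_eq]) hy

theorem integrable_of_continuous_of_isCompact_measSupport [IsFiniteMeasure μ]
    (hcompact : IsCompact (measSupport μ)) {g : ℝ → ℝ} (hg : Continuous g) :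
    Integrable g μ := by
  rw [← Measure.restrict_eq_self_of_ae_mem (ae_mem_measSupport (μ := μ))]
  exact hg.continuousOn.integrableOn_compact hcompact

/-- Integration of polynomials against a measure, as a linear functional. -/
noncomputable def polyIntegral (μ : Measure ℝ)
    (hint : ∀ f : ℝ[X], Integrable (fun y => f.eval y) μ) : ℝ[X] →ₗ[ℝ] ℝ where
  toFun f := ∫ y, f.eval y ∂μ
  map_add' f g := by
    simp only [eval_add]
    exact integral_add (hint f) (hint g)
  map_smul' c f := by
    simp only [eval_smul, smul_eq_mul, RingHom.id_apply]
    exact integral_const_mul c _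

theorem polyIntegral_apply (hint : ∀ f : ℝ[X], Integrable (fun y => f.eval y) μ) (f : ℝ[X]) :
    polyIntegral μ hint f = ∫ y, f.eval y ∂μ := rfl

theorem sq_mul_polyIntegral_sq_le (hint : ∀ f : ℝ[X], Integrable (fun y => f.eval y) μ)
    {x δ : ℝ} (hδ : 0 ≤ δ) (hx : ∀ y ∈ measSupport μ, δ ≤ |y - x|) (f : ℝ[X]) :
    δ ^ 2 * polyIntegral μ hint (f ^ 2) ≤ polyIntegral μ hint (((X - C x) * f) ^ 2) := by
  rw [← smul_eq_mul, ← map_smul, polyIntegral_apply, polyIntegral_apply]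
  refine integral_mono_ae (hint _) (hint _) ?_
  filter_upwards [ae_mem_measSupport] with y hy
  have := pow_le_pow_left₀ hδ (hx y hy) 2
  rw [sq_abs] at this
  simp only [eval_smul, eval_pow, eval_mul, eval_sub, eval_X, eval_C, smul_eq_mul, mul_pow]
  exact mul_le_mul_of_nonneg_right this (sq_nonneg _)

/-- Near a point of the support, some polynomial has its square concentrated. -/
theorem exists_polyIntegral_lt_of_mem_measSupport [IsProbabilityMeasure μ]
    (hcompact : IsCompact (measSupport μ))
    (hint : ∀ f : ℝ[X], Integrable (fun y => f.eval y) μ)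
    {x : ℝ} (hx : x ∈ measSupport μ) {ε : ℝ} (hε : 0 < ε) :
    ∃ f : ℝ[X], polyIntegral μ hint (((X - C x) * f) ^ 2) <
      ε ^ 2 * polyIntegral μ hint (f ^ 2) := by
  obtain ⟨R, hR⟩ := hcompact.isBounded.subset_closedBall x
  set M := max R ε
  have hM0 : 0 < M := lt_max_of_lt_right hε
  have hεM : ε ≤ M := le_max_right _ _
  have hSM : ∀ y ∈ measSupport μ, (y - x) ^ 2 ≤ M ^ 2 := fun y hy => by
    have h1 := hR hy
    rw [Metric.mem_closedBall, Real.dist_eq] at h1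
    rw [← sq_abs (y - x)]
    exact pow_le_pow_left₀ (abs_nonneg _) (h1.trans (le_max_left _ _)) 2
  set m := μ.real (Metric.ball x (ε / 2))
  have hm0 : 0 < m :=
    ENNReal.toReal_pos (hx _ (Metric.ball_mem_nhds x (half_pos hε))).ne' (measure_ne_top _ _)
  set r₁ := 1 - (ε / 2) ^ 2 / M ^ 2 with hr₁
  set r₂ := 1 - ε ^ 2 / M ^ 2 with hr₂
  have hM2 : 0 < M ^ 2 := by positivity
  have hr₂0 : 0 ≤ r₂ := by
    rw [hr₂, sub_nonneg, div_le_one hM2]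
    exact pow_le_pow_left₀ hε.le hεM 2
  have hr₁₂ : r₂ < r₁ := by
    rw [hr₁, hr₂]
    gcongr
    linarith
  have hr₁0 : 0 < r₁ := hr₂0.trans_lt hr₁₂
  obtain ⟨k, hk⟩ : ∃ k : ℕ, M ^ 2 * (r₂ ^ k) ^ 2 < 3 / 4 * ε ^ 2 * (r₁ ^ k) ^ 2 * m := by
    obtain ⟨k, hk⟩ := exists_pow_lt_of_lt_one (x := 3 / 4 * ε ^ 2 * m / M ^ 2) (by positivity)
      (show (r₂ / r₁) ^ 2 < 1 from
        pow_lt_one₀ (by positivity) ((div_lt_one hr₁0).mpr hr₁₂) two_ne_zero)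
    refine ⟨k, ?_⟩
    rw [← pow_mul, mul_comm 2 k, pow_mul, div_pow, div_pow, lt_div_iff₀ hM2,
      div_mul_eq_mul_div, div_lt_iff₀ (by positivity)] at hk
    linarith
  set f : ℝ[X] := (1 - C (M ^ 2)⁻¹ * (X - C x) ^ 2) ^ k with hf
  have hfe : ∀ y, f.eval y = (1 - (y - x) ^ 2 / M ^ 2) ^ k := fun y => by
    simp [hf, div_eq_inv_mul]
  refine ⟨f, sub_neg.mp ?_⟩
  rw [← smul_eq_mul (ε ^ 2), ← map_smul, ← map_sub, polyIntegral_apply]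
  let B := Metric.ball x (ε / 2)
  have hBm : MeasurableSet B := Metric.isOpen_ball.measurableSet
  set c := 3 / 4 * ε ^ 2 * (r₁ ^ k) ^ 2
  have hindint : Integrable (B.indicator fun _ => c) μ := (integrable_const c).indicator hBm
  have hpt : ∀ᵐ y ∂μ, (((X - C x) * f) ^ 2 - ε ^ 2 • f ^ 2).eval y ≤
      M ^ 2 * (r₂ ^ k) ^ 2 - B.indicator (fun _ => c) y := by
    filter_upwards [ae_mem_measSupport] with y hy
    have hev : (((X - C x) * f) ^ 2 - ε ^ 2 • f ^ 2).eval y =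
        ((y - x) ^ 2 - ε ^ 2) * f.eval y ^ 2 := by
      simp only [eval_sub, eval_pow, eval_mul, eval_X, eval_C, eval_smul, smul_eq_mul]
      ring
    rw [hev]
    have hnn : 0 ≤ M ^ 2 * (r₂ ^ k) ^ 2 := by positivity
    by_cases hyB : y ∈ B
    · rw [Set.indicator_of_mem hyB]
      have h1 : (y - x) ^ 2 ≤ (ε / 2) ^ 2 := by
        rw [← sq_abs (y - x), ← Real.dist_eq]
        exact pow_le_pow_left₀ dist_nonneg (Metric.mem_ball.mp hyB).le 2
      have h2 : (r₁ ^ k) ^ 2 ≤ f.eval y ^ 2 := by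
        rw [hfe, hr₁]
        gcongr
      have h3 : (y - x) ^ 2 - ε ^ 2 ≤ -(3 / 4 * ε ^ 2) := by linarith
      have h4 : ((y - x) ^ 2 - ε ^ 2) * f.eval y ^ 2 ≤ -(3 / 4 * ε ^ 2) * f.eval y ^ 2 := by
        gcongr
      have h5 : c ≤ 3 / 4 * ε ^ 2 * f.eval y ^ 2 := mul_le_mul_of_nonneg_left h2 (by positivity)
      linarith
    · rw [Set.indicator_of_notMem hyB, sub_zero]
      rcases le_total ((y - x) ^ 2) (ε ^ 2) with h | h
      · exact (mul_nonpos_of_nonpos_of_nonneg (by linarith) (sq_nonneg _)).trans hnn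
      · have h1 : f.eval y ^ 2 ≤ (r₂ ^ k) ^ 2 := by
          rw [hfe, hr₂]
          have : 0 ≤ 1 - (y - x) ^ 2 / M ^ 2 := by
            rw [sub_nonneg, div_le_one hM2]
            exact hSM y hy
          gcongr
        have h2 : (y - x) ^ 2 - ε ^ 2 ≤ M ^ 2 := by
          linarith [hSM y hy, sq_nonneg ε]
        exact mul_le_mul h2 h1 (sq_nonneg _) hM2.le
  calc ∫ y, (((X - C x) * f) ^ 2 - ε ^ 2 • f ^ 2).eval y ∂μ
      ≤ ∫ y, (M ^ 2 * (r₂ ^ k) ^ 2 - B.indicator (fun _ => c) y) ∂μ := by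
        refine integral_mono_ae (hint _) ?_ hpt
        exact (integrable_const _).sub hindint
    _ = M ^ 2 * (r₂ ^ k) ^ 2 - m * c := by
        rw [integral_sub (integrable_const _) hindint, integral_indicator_const c hBm,
          integral_const, probReal_univ, one_smul, smul_eq_mul]
    _ < 0 := by linarith

end Support

theorem exists_forall_abs_le_of_periodic {a : ℕ → ℝ} {p : ℕ} (hp : 1 ≤ p)
    (hper : ∀ n, 1 ≤ n → a (n + p) = a n) : ∃ A, ∀ n, 1 ≤ n → |a n| ≤ A := by
  refine ⟨∑ i ∈ Finset.range (p + 1), |a i|, fun n => ?_⟩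
  induction n using Nat.strong_induction_on with
  | _ n ih =>
    intro hn
    rcases le_or_gt n p with h | h
    · exact Finset.single_le_sum (f := fun i => |a i|) (fun _ _ => abs_nonneg _)
        (Finset.mem_range.mpr (by omega))
    · have h1 := hper (n - p) (by omega)
      rw [Nat.sub_add_cancel h.le] at h1
      rw [h1]
      exact ih (n - p) (by omega) (by omega)

/-- **Proposition 2.6.** For a probability measure `μ` on `ℝ` with compact infinite
support whose Jacobi parameters are periodic, `z₀ ∈ ℂ` is a limit of zeros of the
orthonormal polynomials `p_n` if and only if `z₀` lies in the support of `μ`. -/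
theorem oprl_periodic_limits_of_zeros_eq_support
    (μ : Measure ℝ) [IsProbabilityMeasure μ]
    (hcompact : IsCompact (measSupport μ))
    (hinf : (measSupport μ).Infinite)
    (P : ℕ → Polynomial ℝ)
    (hdeg : ∀ n, (P n).natDegree = n)
    (hlead : ∀ n, 0 < (P n).leadingCoeff)
    (horth : ∀ n m, ∫ x, (P n).eval x * (P m).eval x ∂μ = if n = m then 1 else 0)
    (p : ℕ) (hp : 1 ≤ p) (a b : ℕ → ℝ)
    (ha : ∀ n, 1 ≤ n → 0 < a n)
    (hpera : ∀ n, 1 ≤ n → a (n + p) = a n)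
    (hperb : ∀ n, 1 ≤ n → b (n + p) = b n)
    (hPrec0 : (X : Polynomial ℝ) * P 0 = a 1 • P 1 + b 1 • P 0)
    (hPrec : ∀ n, 1 ≤ n →
      (X : Polynomial ℝ) * P n = a (n + 1) • P (n + 1) + b (n + 1) • P n + a n • P (n - 1))
    (z₀ : ℂ) :
    (∃ z : ℕ → ℂ, (∀ n, 1 ≤ n → aeval (z n) (P n) = 0) ∧ Tendsto z atTop (nhds z₀)) ↔
      ∃ x : ℝ, x ∈ measSupport μ ∧ z₀ = (x : ℂ) := by
  have hint : ∀ f : ℝ[X], Integrable (fun y => f.eval y) μ := fun f =>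
    integrable_of_continuous_of_isCompact_measSupport hcompact f.continuous
  set L := polyIntegral μ hint with hL
  have hLorth : ∀ n m, L (P n * P m) = if n = m then 1 else 0 := fun n m => by
    simp only [hL, polyIntegral_apply, eval_mul]
    exact horth n m
  have haeval : ∀ (n : ℕ) (x : ℝ), aeval (x : ℂ) (P n) = (((P n).eval x : ℝ) : ℂ) := fun n x =>
    aeval_algebraMap_apply_eq_algebraMap_eval x (P n)
  constructor
  · rintro ⟨z, hz, hlim⟩
    have hreal : ∀ n, 1 ≤ n → z n = ((z n).re : ℂ) := fun n hn =>
      Complex.ext rfl (im_eq_zero_of_aeval_eq_zero hdeg hlead hLorth (hz n hn))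
    have hroot : ∀ n, 1 ≤ n → (P n).eval (z n).re = 0 := fun n hn => by
      have := hz n hn
      rw [hreal n hn, haeval] at this
      exact_mod_cast this
    have hre : Tendsto (fun n => (z n).re) atTop (nhds z₀.re) :=
      (Complex.continuous_re.tendsto z₀).comp hlim
    have hz₀ : z₀ = (z₀.re : ℂ) := by
      refine tendsto_nhds_unique hlim
        (((Complex.continuous_ofReal.tendsto z₀.re).comp hre).congr' ?_)
      filter_upwards [eventually_ge_atTop 1] with n hn
      exact (hreal n hn).symm
    refine ⟨z₀.re, ?_, hz₀⟩
    by_contra hx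
    obtain ⟨d, hd, hdist⟩ := exists_pos_forall_le_abs_sub_of_notMem hx
    obtain ⟨A, hA⟩ := exists_forall_abs_le_of_periodic hp hpera
    have hA0 : 0 ≤ A := (abs_nonneg _).trans (hA 1 le_rfl)
    set ε := min (d / 2) (d ^ 2 / (4 * (A + 1)))
    have hε0 : 0 < ε := lt_min (half_pos hd) (by positivity)
    have hεd : ε ≤ d / 2 := min_le_left _ _
    have hεA : A * ε < d ^ 2 / 4 := by
      have h1 : ε * (4 * (A + 1)) ≤ d ^ 2 :=
        (le_div_iff₀ (by positivity)).mp (min_le_right _ _)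
      linarith
    have hev : ∀ᶠ n in atTop, |(z n).re - z₀.re| ≤ ε := by
      filter_upwards [Metric.tendsto_nhds.mp hre ε hε0] with n hn
      rw [Real.dist_eq] at hn
      exact hn.le
    obtain ⟨N, hN⟩ := eventually_atTop.mp hev
    have hkey := sq_mul_sq_le_of_consecutive_roots hdeg hlead hLorth hPrec0 hPrec
      (x := z₀.re) (d := d) (ε := ε)
      (fun w f hw => sq_mul_polyIntegral_sq_le hint (by linarith) (fun y hy => by
        have h1 := hdist y hy
        have h2 := abs_sub_le y w z₀.re
        linarith) f)
      (fun f => sq_mul_polyIntegral_sq_le hint hd.le hdist f)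
      (hroot (N + 1) (by omega)) (hN (N + 1) (by omega))
      (hroot (N + 1 + 1) (by omega)) (hN (N + 1 + 1) (by omega))
    have h1 : a (N + 1 + 1) ^ 2 ≤ A ^ 2 := by
      rw [← sq_abs]
      exact pow_le_pow_left₀ (abs_nonneg _) (hA _ (by omega)) 2
    have h2 : (d / 2) ^ 2 ≤ (d - ε) ^ 2 := pow_le_pow_left₀ (by linarith) (by linarith) 2
    have h3 : (A * ε) ^ 2 < (d ^ 2 / 4) ^ 2 := pow_lt_pow_left₀ hεA (by positivity) two_ne_zero
    have h4 : d ^ 2 * (d / 2) ^ 2 ≤ d ^ 2 * (d - ε) ^ 2 := by gcongr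
    have h5 : 2 * a (N + 1 + 1) ^ 2 * ε ^ 2 ≤ 2 * A ^ 2 * ε ^ 2 := by gcongr
    have h6 : 0 < d ^ 4 := by positivity
    nlinarith
  · rintro ⟨x, hx, rfl⟩
    have hexists : ∀ n, ∃ w : ℝ, 1 ≤ n → (P n).eval w = 0 ∧
        ∀ v, (P n).eval v = 0 → |w - x| ≤ |v - x| := by
      intro n
      rcases Nat.eq_zero_or_pos n with rfl | hn
      · exact ⟨0, fun h => absurd h (by norm_num)⟩
      have hne : P n ≠ 0 := leadingCoeff_ne_zero.mp (hlead n).ne'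
      have hmem : ∀ v, v ∈ (P n).roots.toFinset ↔ (P n).eval v = 0 := fun v => by
        rw [Multiset.mem_toFinset, mem_roots hne, IsRoot]
      obtain ⟨v, hv⟩ := (splits_of_orthonormal hdeg hlead hLorth n).exists_eval_eq_zero
        (by rw [degree_eq_natDegree hne, hdeg]; exact_mod_cast hn.ne')
      obtain ⟨w, hw, hmin⟩ := (P n).roots.toFinset.exists_min_image (fun v => |v - x|)
        ⟨v, (hmem v).mpr hv⟩
      exact ⟨w, fun _ => ⟨(hmem w).mp hw, fun u hu => hmin u ((hmem u).mpr hu)⟩⟩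
    choose w hw using hexists
    refine ⟨fun n => (w n : ℂ), fun n hn => ?_, ?_⟩
    · rw [haeval, (hw n hn).1, Complex.ofReal_zero]
    refine (Complex.continuous_ofReal.tendsto x).comp (Metric.tendsto_nhds.mpr fun ε hε => ?_)
    obtain ⟨f, hf⟩ := exists_polyIntegral_lt_of_mem_measSupport hcompact hint hx hε
    filter_upwards [eventually_ge_atTop (f.natDegree + 2)] with n hn
    rw [Real.dist_eq]
    by_contra! hlt
    exact hf.not_ge (sq_mul_map_sq_le_of_le_abs_roots hdeg hlead hLorth (by omega) hε.le
      fun v hv => hlt.trans ((hw n (by omega)).2 v hv))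
end
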